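/- Let f ∈ L¹(−1,1) and g ∈ LlogL, and suppose that f·T(g·χ_A) ∈ L¹(−1,1) for every Borel set A ⊆ (−1,1). Then g·T(f) ∈ L¹(−1,1) and the Parseval formula ∫_{−1}^{1} f(x)·T(g)(x) dx = − ∫_{−1}^{1} g(x)·T(f)(x) dx holds. -/

import Mathlib

open MeasureTheory Filter Set

/-- Lebesgue measure restricted to the interval `(-1, 1)`. -/
noncomputable def mIoo : MeasureTheory.Measure ℝ :=
  MeasureTheory.volume.restrict (Set.Ioo (-1 : ℝ) 1)

/-- The finite Hilbert transform: `T f t` is the principal value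
`lim_{ε→0⁺} (1/π) (∫_{-1}^{t-ε} + ∫_{t+ε}^{1}) f x / (x - t) dx`. -/
noncomputable def FHT (f : ℝ → ℂ) (t : ℝ) : ℂ :=
  limUnder (nhdsWithin (0 : ℝ) (Set.Ioi 0)) fun ε =>
    (Real.pi : ℂ)⁻¹ * ((∫ x in Set.Ioo (-1 : ℝ) (t - ε), f x / (↑x - ↑t)) +
      ∫ x in Set.Ioo (t + ε) (1 : ℝ), f x / (↑x - ↑t))

/-- `w x = √(1 - x²)`. -/
noncomputable def w (x : ℝ) : ℝ := Real.sqrt (1 - x ^ 2)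

/-- The operator `Ť f = -w · T(f / w)`. -/
noncomputable def Tcheck (f : ℝ → ℂ) (t : ℝ) : ℂ :=
  -((w t : ℂ) * FHT (fun y => f y / (w y : ℂ)) t)

/-- The operator `T̂ f = -(1/w) · T(w f)`. -/
noncomputable def That (f : ℝ → ℂ) (t : ℝ) : ℂ :=
  -(FHT (fun y => (w y : ℂ) * f y) t / (w t : ℂ))

/-- Membership in the Zygmund space `L_exp^α`: `f` is measurable and there is `λ > 0` with
`∫ exp(λ |f|^(1/α)) < ∞`. -/
def MemLexpPow (α : ℝ) (f : ℝ → ℂ) : Prop :=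
  MeasureTheory.AEStronglyMeasurable f mIoo ∧
    ∃ l > (0 : ℝ),
      ∫⁻ x, ENNReal.ofReal (Real.exp (l * ‖f x‖ ^ ((1 : ℝ) / α))) ∂mIoo < ⊤

/-- Membership in the Zygmund space `L_exp`: `f` is measurable and there is `λ > 0` with
`∫ exp(λ |f|) < ∞`. -/
def MemLexp (f : ℝ → ℂ) : Prop :=
  MeasureTheory.AEStronglyMeasurable f mIoo ∧
    ∃ l > (0 : ℝ), ∫⁻ x, ENNReal.ofReal (Real.exp (l * ‖f x‖)) ∂mIoo < ⊤

/-- Membership in the Zygmund space `L log L`: `g` is measurable and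
`∫ |g| log(2 + |g|) < ∞`. -/
def MemLlogL (g : ℝ → ℂ) : Prop :=
  MeasureTheory.AEStronglyMeasurable g mIoo ∧
    MeasureTheory.Integrable (fun x => ‖g x‖ * Real.log (2 + ‖g x‖)) mIoo

open scoped Topology

theorem integrable_poisson {y : ℝ} (hy : 0 < y) (t : ℝ) :
    Integrable fun x : ℝ => y / ((x - t) ^ 2 + y ^ 2) := by
  have h := ((integrable_inv_one_add_sq.comp_div hy.ne').const_mul y⁻¹).comp_sub_right t
  refine h.congr (ae_of_all _ fun x => ?_)
  have : 0 < (x - t) ^ 2 + y ^ 2 := by positivity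
  have : 0 < 1 + ((x - t) / y) ^ 2 := by positivity
  simp only
  field_simp
  ring

theorem integral_poisson {y : ℝ} (hy : 0 < y) (t : ℝ) :
    ∫ x : ℝ, y / ((x - t) ^ 2 + y ^ 2) = Real.pi := by
  have h := integral_sub_right_eq_self (μ := volume)
    (fun x : ℝ => y⁻¹ * (1 + (x / y) ^ 2)⁻¹) t
  rw [integral_const_mul y⁻¹ fun x : ℝ => (1 + (x / y) ^ 2)⁻¹,
    Measure.integral_comp_div (fun x : ℝ => (1 + x ^ 2)⁻¹),
    integral_univ_inv_one_add_sq, abs_of_pos hy, smul_eq_mul, inv_mul_cancel_left₀ hy.ne'] at h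
  rw [← h]
  refine integral_congr_ae (ae_of_all _ fun x => ?_)
  have : 0 < (x - t) ^ 2 + y ^ 2 := by positivity
  have : 0 < 1 + ((x - t) / y) ^ 2 := by positivity
  simp only
  field_simp
  ring

/-- Dyadic domination of the Poisson kernel near its singularity. -/
theorem exists_dyadic_poisson_bound {y r s : ℝ} (hy : 0 < y) (hyr : y ≤ r) (hs : |s| ≤ r / 2)
    {N : ℕ} (hN : r < 2 ^ N * y) :
    ∃ k ∈ (Finset.range N).filter (fun k : ℕ => 2 ^ k * y ≤ r),
      |s| ≤ 2 ^ k * y ∧ y / (s ^ 2 + y ^ 2) ≤ 4 / (4 ^ k * y) := by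
  have hr : 0 < r := hy.trans_le hyr
  have hex : ∃ k : ℕ, |s| ≤ 2 ^ k * y := ⟨N, by linarith⟩
  classical
  set k := Nat.find hex with hk
  have hks : |s| ≤ 2 ^ k * y := Nat.find_spec hex
  have hpos : 0 < s ^ 2 + y ^ 2 := by positivity
  have key : 2 ^ k * y ≤ r ∧ y / (s ^ 2 + y ^ 2) ≤ 4 / (4 ^ k * y) := by
    rcases hk0 : k with _ | m
    · refine ⟨by simpa using hyr, ?_⟩
      rw [div_le_div_iff₀ hpos (by positivity)]
      nlinarith [sq_nonneg s, sq_nonneg y]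
    · have hm : 2 ^ m * y < |s| := by
        have := Nat.find_min hex (m := m) (by omega)
        exact not_le.mp this
      have h2 : (0 : ℝ) < 2 ^ m := by positivity
      refine ⟨by rw [pow_succ]; linarith, ?_⟩
      have hsq : (2 ^ m * y) ^ 2 ≤ s ^ 2 := by
        rw [← sq_abs s]; gcongr
      have h4 : (4 : ℝ) ^ m = (2 ^ m) ^ 2 := by rw [← pow_mul, mul_comm, pow_mul]; norm_num
      rw [div_le_div_iff₀ hpos (by positivity), pow_succ, h4]
      nlinarith [sq_nonneg y]
  refine ⟨k, ?_, hks, key.2⟩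
  rw [Finset.mem_filter, Finset.mem_range]
  refine ⟨?_, key.1⟩
  by_contra hcon
  have : (2 : ℝ) ^ N ≤ 2 ^ k := pow_le_pow_right₀ (by norm_num) (not_lt.mp hcon)
  nlinarith [key.1]

theorem setIntegral_poisson_mul_le {φ : ℝ → ℝ} {t r δ y : ℝ} (hφ : ∀ x, 0 ≤ φ x)
    (hint : IntegrableOn φ (Metric.closedBall t r))
    (hδ : ∀ ρ, 0 < ρ → ρ ≤ r → ∫ x in Metric.closedBall t ρ, φ x ≤ δ * ρ)
    (hδ0 : 0 ≤ δ) (hy : 0 < y) (hyr : y ≤ r) :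
    ∫ x in Metric.closedBall t (r / 2), y / ((x - t) ^ 2 + y ^ 2) * φ x ≤ 8 * δ := by
  have hr : 0 < r := hy.trans_le hyr
  obtain ⟨N, hN⟩ := pow_unbounded_of_one_lt (r / y) (one_lt_two : (1 : ℝ) < 2)
  rw [div_lt_iff₀ hy] at hN
  set S := (Finset.range N).filter (fun k : ℕ => 2 ^ k * y ≤ r) with hS
  have hSr : ∀ k ∈ S, 2 ^ k * y ≤ r := fun k hk => (Finset.mem_filter.mp hk).2
  have hintk : ∀ k ∈ S, Integrable
      ((Metric.closedBall t (2 ^ k * y)).indicator fun x => 4 / (4 ^ k * y) * φ x) := by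
    intro k hk
    rw [integrable_indicator_iff Metric.isClosed_closedBall.measurableSet]
    exact (hint.mono_set (Metric.closedBall_subset_closedBall (hSr k hk))).const_mul _
  calc ∫ x in Metric.closedBall t (r / 2), y / ((x - t) ^ 2 + y ^ 2) * φ x
      = ∫ x, (Metric.closedBall t (r / 2)).indicator
          (fun x => y / ((x - t) ^ 2 + y ^ 2) * φ x) x := by
        rw [integral_indicator Metric.isClosed_closedBall.measurableSet]
    _ ≤ ∫ x, ∑ k ∈ S, (Metric.closedBall t (2 ^ k * y)).indicator
          (fun x => 4 / (4 ^ k * y) * φ x) x := by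
        refine integral_mono_of_nonneg (ae_of_all _ fun x => ?_)
          (integrable_finsetSum _ hintk) (ae_of_all _ fun x => ?_)
        · refine indicator_nonneg (fun x _ => mul_nonneg ?_ (hφ x)) x
          positivity
        · simp only
          have hnn : ∀ k ∈ S, 0 ≤ (Metric.closedBall t (2 ^ k * y)).indicator
              (fun x => 4 / (4 ^ k * y) * φ x) x := fun k _ =>
            indicator_nonneg (fun x _ => mul_nonneg (by positivity) (hφ x)) x
          by_cases hx : x ∈ Metric.closedBall t (r / 2)
          · rw [indicator_of_mem hx]
            rw [Metric.mem_closedBall, Real.dist_eq] at hx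
            obtain ⟨k, hk, hk1, hk2⟩ := exists_dyadic_poisson_bound hy hyr hx hN
            refine le_trans ?_ (Finset.single_le_sum hnn hk)
            rw [indicator_of_mem (by rwa [Metric.mem_closedBall, Real.dist_eq])]
            exact mul_le_mul_of_nonneg_right hk2 (hφ x)
          · rw [indicator_of_notMem hx]
            exact Finset.sum_nonneg hnn
    _ = ∑ k ∈ S, 4 / (4 ^ k * y) * ∫ x in Metric.closedBall t (2 ^ k * y), φ x := by
        rw [integral_finsetSum _ hintk]
        refine Finset.sum_congr rfl fun k _ => ?_
        rw [integral_indicator Metric.isClosed_closedBall.measurableSet, integral_const_mul]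
    _ ≤ ∑ k ∈ S, 4 * δ * (1 / 2) ^ k := by
        refine Finset.sum_le_sum fun k hk => ?_
        have h4 : (4 : ℝ) ^ k = 2 ^ k * 2 ^ k := by rw [← mul_pow]; norm_num
        calc _ ≤ 4 / (4 ^ k * y) * (δ * (2 ^ k * y)) := by
              gcongr
              exact hδ _ (by positivity) (hSr k hk)
          _ = 4 * δ * (1 / 2) ^ k := by
              rw [h4, one_div, inv_pow]
              field_simp
    _ ≤ ∑ k ∈ Finset.range N, 4 * δ * (1 / 2) ^ k :=
        Finset.sum_le_sum_of_subset_of_nonneg (Finset.filter_subset _ _)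
          fun _ _ _ => by positivity
    _ ≤ 8 * δ := by
        rw [← Finset.mul_sum]
        have := sum_geometric_two_le N
        nlinarith

/-- Almost every point is a Lebesgue point for the Poisson means. -/
theorem ae_tendsto_poisson_norm_sub {f : ℝ → ℂ}
    (hf : Integrable fun x => ((1 + x ^ 2)⁻¹ : ℝ) • f x) :
    ∀ᵐ t, Tendsto (fun y => ∫ x, y / ((x - t) ^ 2 + y ^ 2) * ‖f x - f t‖)
      (𝓝[>] (0 : ℝ)) (𝓝 0) := by
  have hloc : LocallyIntegrable f := by
    have h := LocallyIntegrable.continuous_smul (g := fun x : ℝ => 1 + x ^ 2)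
      (by fun_prop) hf.locallyIntegrable
    refine h.congr (ae_of_all _ fun x => ?_)
    have : 1 + x ^ 2 ≠ 0 := by positivity
    simp only
    rw [smul_smul, mul_inv_cancel₀ this, one_smul]
  filter_upwards [IsUnifLocDoublingMeasure.ae_tendsto_average_norm_sub volume hloc 1] with t ht
  have havg : Tendsto (fun ρ : ℝ => ⨍ x in Metric.closedBall t ρ, ‖f x - f t‖)
      (𝓝[>] (0 : ℝ)) (𝓝 0) := by
    refine ht (fun _ => t) (fun ρ => ρ) tendsto_id ?_
    filter_upwards [self_mem_nhdsWithin] with ρ hρ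
    simpa using (mem_Ioi.mp hρ).le
  set φ : ℝ → ℝ := fun x => ‖f x - f t‖ with hφ
  have hφ0 : ∀ x, 0 ≤ φ x := fun x => norm_nonneg _
  have hφloc : LocallyIntegrable φ := fun x =>
    let ⟨s, hs, h⟩ := (hloc.sub (locallyIntegrable_const (f t))) x
    ⟨s, hs, h.norm⟩
  have hφw : Integrable fun x => (1 + x ^ 2)⁻¹ * φ x := by
    refine (hf.sub (integrable_inv_one_add_sq.smul_const (f t))).norm.congr
      (ae_of_all _ fun x => ?_)
    have : 0 ≤ (1 + x ^ 2)⁻¹ := by positivity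
    simp only [Pi.sub_apply, ← smul_sub, norm_smul, Real.norm_eq_abs, abs_of_nonneg this, hφ]
  rw [Metric.tendsto_nhds]
  intro ε hε
  have hδ : 0 < ε / 64 := by positivity
  obtain ⟨r, hr0, hr⟩ : ∃ r > 0, ∀ ρ, 0 < ρ → ρ ≤ r →
      ∫ x in Metric.closedBall t ρ, φ x ≤ (ε / 32) * ρ := by
    have h1 := (Metric.tendsto_nhds.mp havg) (ε / 64) hδ
    obtain ⟨r, hr0, hr⟩ := mem_nhdsGT_iff_exists_Ioc_subset.mp h1
    refine ⟨r, hr0, fun ρ hρ hρr => ?_⟩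
    have h2 : dist (⨍ x in Metric.closedBall t ρ, φ x) 0 < ε / 64 := hr ⟨hρ, hρr⟩
    rw [Real.dist_eq, sub_zero, setAverage_eq, smul_eq_mul, Measure.real, Real.volume_closedBall,
      ENNReal.toReal_ofReal (by positivity)] at h2
    have h3 := (le_abs_self _).trans h2.le
    rw [inv_mul_le_iff₀ (by positivity)] at h3
    linarith
  set C : ℝ := 2 + (1 + 2 * t ^ 2) / (r / 2) ^ 2 with hC
  have hC0 : 0 < C := by positivity
  set J := ∫ x, (1 + x ^ 2)⁻¹ * φ x with hJ
  have hJ0 : 0 ≤ J := integral_nonneg fun x => mul_nonneg (by positivity) (hφ0 x)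
  have htail : ∀ y, 0 < y → ∀ x ∉ Metric.closedBall t (r / 2),
      y / ((x - t) ^ 2 + y ^ 2) * φ x ≤ y * C * ((1 + x ^ 2)⁻¹ * φ x) := by
    intro y hy x hx
    rw [Metric.mem_closedBall, Real.dist_eq, not_le] at hx
    rw [← mul_assoc]
    refine mul_le_mul_of_nonneg_right ?_ (hφ0 x)
    have hsq : (r / 2) ^ 2 ≤ (x - t) ^ 2 := by
      rw [← sq_abs (x - t)]; gcongr
    rw [← div_eq_mul_inv, div_le_div_iff₀ (by positivity) (by positivity), mul_assoc]
    refine mul_le_mul_of_nonneg_left ?_ hy.le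
    have h1 : (1 + 2 * t ^ 2) ≤ (1 + 2 * t ^ 2) / (r / 2) ^ 2 * (x - t) ^ 2 := by
      rw [div_mul_eq_mul_div, le_div_iff₀ (by positivity)]
      gcongr
    have h2 : 1 + x ^ 2 ≤ C * (x - t) ^ 2 := by
      rw [hC, add_mul]
      nlinarith [sq_nonneg (x - 2 * t)]
    nlinarith [sq_nonneg y]
  have hev : ∀ᶠ y : ℝ in 𝓝[>] 0, y ≤ r ∧ y * C * J < ε / 2 := by
    have h1 : ∀ᶠ y : ℝ in 𝓝[>] 0, y ≤ r := by
      filter_upwards [Ioc_mem_nhdsGT hr0] with y hy using hy.2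
    have h2 : Tendsto (fun y : ℝ => y * C * J) (𝓝[>] 0) (𝓝 0) := by
      have : Continuous fun y : ℝ => y * C * J := by fun_prop
      have h := this.tendsto 0
      simp only [zero_mul] at h
      exact h.mono_left nhdsWithin_le_nhds
    exact h1.and (h2.eventually (gt_mem_nhds (by positivity)))
  filter_upwards [hev, self_mem_nhdsWithin] with y hy hy0
  have hy0 : 0 < y := hy0
  have hin : IntegrableOn (fun x => y / ((x - t) ^ 2 + y ^ 2) * φ x)
      (Metric.closedBall t (r / 2)) := by
    refine (LocallyIntegrable.continuous_smul
      (g := fun x => y / ((x - t) ^ 2 + y ^ 2)) ?_ hφloc).integrableOn_isCompact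
      (isCompact_closedBall t (r / 2))
    refine Continuous.div (by fun_prop) (by fun_prop) fun x => by positivity
  have hout : IntegrableOn (fun x => y / ((x - t) ^ 2 + y ^ 2) * φ x)
      (Metric.closedBall t (r / 2))ᶜ := by
    refine Integrable.mono' (hφw.const_mul (y * C)).integrableOn ?_ ?_
    · refine AEStronglyMeasurable.mul ?_ hφloc.aestronglyMeasurable.restrict
      exact (integrable_poisson hy0 t).aestronglyMeasurable.restrict
    · refine ae_restrict_of_forall_mem Metric.isClosed_closedBall.measurableSet.compl
        fun x hx => ?_
      rw [Real.norm_eq_abs, abs_of_nonneg (mul_nonneg (by positivity) (hφ0 x))]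
      exact htail y hy0 x hx
  have hle1 := setIntegral_poisson_mul_le hφ0
    (hφloc.integrableOn_isCompact (isCompact_closedBall t r)) hr (by positivity) hy0 hy.1
  have hle2 : ∫ x in (Metric.closedBall t (r / 2))ᶜ, y / ((x - t) ^ 2 + y ^ 2) * φ x
      ≤ y * C * J := by
    calc _ ≤ ∫ x in (Metric.closedBall t (r / 2))ᶜ, y * C * ((1 + x ^ 2)⁻¹ * φ x) :=
          setIntegral_mono_on hout (hφw.const_mul (y * C)).integrableOn
            Metric.isClosed_closedBall.measurableSet.compl (htail y hy0)
      _ ≤ ∫ x, y * C * ((1 + x ^ 2)⁻¹ * φ x) :=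
          setIntegral_le_integral (hφw.const_mul (y * C)) (ae_of_all _ fun x =>
            mul_nonneg (by positivity) (mul_nonneg (by positivity) (hφ0 x)))
      _ = y * C * J := integral_const_mul _ _
  have hsum := integral_add_compl₀
    (Metric.isClosed_closedBall (x := t) (ε := r / 2)).measurableSet.nullMeasurableSet
    (integrableOn_univ.mp (by
      rw [← union_compl_self (Metric.closedBall t (r / 2))]; exact hin.union hout))
  rw [Real.dist_eq, sub_zero, abs_of_nonneg (integral_nonneg fun x =>
    mul_nonneg (by positivity) (hφ0 x)), ← hsum]
  linarith [hy.2]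

/-- The conjugate Poisson means `∫ (x - t) / ((x - t)² + y²) f x dx`. -/
noncomputable def conjPoisson (f : ℝ → ℂ) (y t : ℝ) : ℂ :=
  ∫ x, (((x - t) / ((x - t) ^ 2 + y ^ 2) : ℝ) : ℂ) * f x

/-- The Cauchy transform `∫ f x / (x - z) dx`. -/
noncomputable def cauchyT (f : ℝ → ℝ) (z : ℂ) : ℂ := ∫ x, (f x : ℂ) / (x - z)

theorem abs_conjPoisson_kernel_le {y : ℝ} (hy : 0 < y) (s : ℝ) :
    |s / (s ^ 2 + y ^ 2)| ≤ y⁻¹ := by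
  have : 0 < s ^ 2 + y ^ 2 := by positivity
  rw [abs_div, abs_of_pos this, div_le_iff₀ this, inv_mul_eq_div, le_div_iff₀ hy]
  nlinarith [sq_abs s, sq_nonneg (|s| - y), abs_nonneg s]

theorem integrable_conjPoisson_kernel_mul {f : ℝ → ℂ} (hf : Integrable f) {y : ℝ} (hy : 0 < y)
    (t : ℝ) : Integrable fun x => (((x - t) / ((x - t) ^ 2 + y ^ 2) : ℝ) : ℂ) * f x := by
  refine hf.bdd_mul (c := y⁻¹) (Measurable.aestronglyMeasurable (by fun_prop))
    (ae_of_all _ fun x => ?_)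
  rw [Complex.norm_real]
  exact abs_conjPoisson_kernel_le hy _

theorem integrable_poisson_mul {f : ℝ → ℝ} (hf : Integrable f) {y : ℝ} (hy : 0 < y) (t : ℝ) :
    Integrable fun x => y / ((x - t) ^ 2 + y ^ 2) * f x := by
  refine hf.bdd_mul (c := y⁻¹) (Measurable.aestronglyMeasurable (by fun_prop))
    (ae_of_all _ fun x => ?_)
  have : 0 < (x - t) ^ 2 + y ^ 2 := by positivity
  rw [Real.norm_eq_abs, abs_of_nonneg (by positivity), div_le_iff₀ this, inv_mul_eq_div,
    le_div_iff₀ hy]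
  nlinarith [sq_nonneg (x - t)]

theorem im_le_norm_ofReal_sub (x : ℝ) (z : ℂ) : z.im ≤ ‖(x : ℂ) - z‖ := by
  have := Complex.abs_im_le_norm ((x : ℂ) - z)
  simp only [Complex.sub_im, Complex.ofReal_im, zero_sub, abs_neg] at this
  exact (le_abs_self _).trans this

theorem integrable_cauchyT {f : ℝ → ℝ} (hf : Integrable f) {z : ℂ} (hz : 0 < z.im) :
    Integrable fun x : ℝ => (f x : ℂ) / (x - z) := by
  simp only [div_eq_inv_mul]
  refine hf.ofReal.bdd_mul (c := z.im⁻¹) (Measurable.aestronglyMeasurable (by fun_prop))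
    (ae_of_all _ fun x => ?_)
  rw [norm_inv]
  exact inv_anti₀ hz (im_le_norm_ofReal_sub x z)

theorem norm_cauchyT_le {f : ℝ → ℝ} (hf : Integrable f) {z : ℂ} (hz : 0 < z.im) :
    ‖cauchyT f z‖ ≤ (∫ x, |f x|) / z.im := by
  rw [← integral_div]
  refine norm_integral_le_of_norm_le (hf.abs.div_const _) (ae_of_all _ fun x => ?_)
  rw [norm_div, Complex.norm_real, Real.norm_eq_abs]
  exact div_le_div_of_nonneg_left (abs_nonneg _) hz (im_le_norm_ofReal_sub x z)

theorem differentiableAt_cauchyT {f : ℝ → ℝ} (hf : Integrable f) {z : ℂ} (hz : 0 < z.im) :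
    DifferentiableAt ℂ (cauchyT f) z := by
  have hs : {u : ℂ | z.im / 2 < u.im} ∈ 𝓝 z :=
    (isOpen_lt continuous_const Complex.continuous_im).mem_nhds (by
      simp only [mem_ofPred_eq]; linarith)
  refine (hasDerivAt_integral_of_dominated_loc_of_deriv_le (μ := volume)
    (F := fun u (x : ℝ) => (f x : ℂ) / (x - u)) (F' := fun u (x : ℝ) => (f x : ℂ) / (x - u) ^ 2)
    (bound := fun x => ((z.im / 2) ^ 2)⁻¹ * |f x|) hs ?_ (integrable_cauchyT hf hz) ?_ ?_
    (hf.abs.const_mul _) ?_).2.differentiableAt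
  · filter_upwards [hs] with u hu
    have hu : z.im / 2 < u.im := hu
    exact (integrable_cauchyT hf (by linarith)).aestronglyMeasurable
  · simp only [div_eq_mul_inv]
    exact hf.ofReal.aestronglyMeasurable.mul (Measurable.aestronglyMeasurable (by fun_prop))
  · refine ae_of_all _ fun x u hu => ?_
    have hu : z.im / 2 < u.im := hu
    rw [norm_div, norm_pow, Complex.norm_real, Real.norm_eq_abs, div_eq_inv_mul]
    gcongr
    exact hu.le.trans (im_le_norm_ofReal_sub x u)
  · refine ae_of_all _ fun x u hu => ?_
    have hu : z.im / 2 < u.im := hu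
    have hne : (x : ℂ) - u ≠ 0 := by
      rw [← norm_pos_iff]
      exact lt_of_lt_of_le (by linarith) (im_le_norm_ofReal_sub x u)
    have h := (((hasDerivAt_id u).const_sub (x : ℂ)).inv hne).const_mul (f x : ℂ)
    refine h.congr_deriv ?_
    simp only [id, neg_neg, mul_one_div]

theorem inv_ofReal_sub_eq (x t : ℝ) {y : ℝ} (hy : 0 < y) :
    ((x : ℂ) - (t + y * Complex.I))⁻¹ =
      (((x - t) / ((x - t) ^ 2 + y ^ 2) : ℝ) : ℂ) + ((y / ((x - t) ^ 2 + y ^ 2) : ℝ) : ℂ) *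
        Complex.I := by
  have h1 : (x - t) ^ 2 + y ^ 2 ≠ 0 := by positivity
  have h2 : ((x : ℂ) - t) ^ 2 + (y : ℂ) ^ 2 ≠ 0 := by exact_mod_cast h1
  refine inv_eq_of_mul_eq_one_right ?_
  push_cast
  field_simp
  ring_nf
  rw [Complex.I_sq]
  ring

theorem cauchyT_add_mul_I {f : ℝ → ℝ} (hf : Integrable f) (t : ℝ) {y : ℝ} (hy : 0 < y) :
    cauchyT f (t + y * Complex.I) = conjPoisson (fun x => f x) y t +
      ((∫ x, y / ((x - t) ^ 2 + y ^ 2) * f x : ℝ) : ℂ) * Complex.I := by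
  have hI : Integrable fun x =>
      ((y / ((x - t) ^ 2 + y ^ 2) * f x : ℝ) : ℂ) * Complex.I :=
    (integrable_poisson_mul hf hy t).ofReal.mul_const _
  have hI' : Integrable fun x => (((x - t) / ((x - t) ^ 2 + y ^ 2) : ℝ) : ℂ) * (f x : ℂ) :=
    integrable_conjPoisson_kernel_mul hf.ofReal hy t
  rw [cauchyT, conjPoisson, ← integral_complex_ofReal, ← integral_mul_const,
    ← integral_add hI' hI]
  refine integral_congr_ae (ae_of_all _ fun x => ?_)
  simp only [div_eq_mul_inv (f x : ℂ)]
  rw [inv_ofReal_sub_eq x t hy]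
  push_cast
  ring

theorem conjPoisson_ofReal (f : ℝ → ℝ) (y t : ℝ) :
    conjPoisson (fun x => f x) y t =
      ((∫ x, (x - t) / ((x - t) ^ 2 + y ^ 2) * f x : ℝ) : ℂ) := by
  rw [conjPoisson, ← integral_complex_ofReal]
  simp only [Complex.ofReal_mul]

theorem cauchyT_im {f : ℝ → ℝ} (hf : Integrable f) (t : ℝ) {y : ℝ} (hy : 0 < y) :
    (cauchyT f (t + y * Complex.I)).im = ∫ x, y / ((x - t) ^ 2 + y ^ 2) * f x := by
  rw [cauchyT_add_mul_I hf t hy, conjPoisson_ofReal]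
  simp

theorem cauchyT_re {f : ℝ → ℝ} (hf : Integrable f) (t : ℝ) {y : ℝ} (hy : 0 < y) :
    ((cauchyT f (t + y * Complex.I)).re : ℂ) = conjPoisson (fun x => f x) y t := by
  rw [cauchyT_add_mul_I hf t hy, conjPoisson_ofReal]
  simp

theorem cauchyT_im_nonneg {f : ℝ → ℝ} (hf : Integrable f) (hf0 : ∀ x, 0 ≤ f x) {z : ℂ}
    (hz : 0 < z.im) : 0 ≤ (cauchyT f z).im := by
  rw [← Complex.re_add_im z, cauchyT_im hf _ hz]
  exact integral_nonneg fun x => mul_nonneg (by positivity) (hf0 x)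

theorem integrable_inv_one_add_sq_smul {f : ℝ → ℂ} (hf : Integrable f) :
    Integrable fun x => ((1 + x ^ 2)⁻¹ : ℝ) • f x := by
  refine hf.norm.mono' ?_ (ae_of_all _ fun x => ?_)
  · exact integrable_inv_one_add_sq.aestronglyMeasurable.smul hf.aestronglyMeasurable
  · rw [norm_smul, Real.norm_eq_abs, abs_of_nonneg (by positivity)]
    exact mul_le_of_le_one_left (norm_nonneg _) (inv_le_one_of_one_le₀ (by nlinarith))

/-- The Poisson integral has boundary value `π f`. -/
theorem tendsto_poisson_smul {f : ℝ → ℂ} {t : ℝ}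
    (hf : Integrable fun x => ((1 + x ^ 2)⁻¹ : ℝ) • f x)
    (ht : Tendsto (fun y => ∫ x, y / ((x - t) ^ 2 + y ^ 2) * ‖f x - f t‖)
      (𝓝[>] (0 : ℝ)) (𝓝 0)) :
    Tendsto (fun y => ∫ x, (y / ((x - t) ^ 2 + y ^ 2) : ℝ) • f x) (𝓝[>] (0 : ℝ))
      (𝓝 ((Real.pi : ℝ) • f t)) := by
  rw [tendsto_iff_norm_sub_tendsto_zero]
  refine squeeze_zero' (Eventually.of_forall fun _ => norm_nonneg _) ?_ ht
  filter_upwards [self_mem_nhdsWithin] with y hy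
  have hy : 0 < y := hy
  have hb : ∀ x : ℝ, ‖y / ((x - t) ^ 2 + y ^ 2) * (1 + x ^ 2)‖ ≤ 2 * y + (2 * t ^ 2 + 1) / y := by
    intro x
    have h0 : 0 < (x - t) ^ 2 + y ^ 2 := by positivity
    rw [Real.norm_eq_abs, abs_of_nonneg (by positivity), div_mul_eq_mul_div, div_le_iff₀ h0]
    have h1 : (2 * y + (2 * t ^ 2 + 1) / y) * ((x - t) ^ 2 + y ^ 2) ≥
        2 * y * (x - t) ^ 2 + (2 * t ^ 2 + 1) * y := by
      have : (2 * t ^ 2 + 1) / y * ((x - t) ^ 2 + y ^ 2) ≥ (2 * t ^ 2 + 1) * y := by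
        rw [ge_iff_le, div_mul_eq_mul_div, le_div_iff₀ hy]
        nlinarith [mul_nonneg (by positivity : 0 ≤ 2 * t ^ 2 + 1) (sq_nonneg (x - t))]
      nlinarith [pow_pos hy 3]
    nlinarith [mul_nonneg hy.le (sq_nonneg (x - 2 * t))]
  have hint : Integrable fun x => (y / ((x - t) ^ 2 + y ^ 2) : ℝ) • f x := by
    refine (hf.bdd_smul _ (φ := fun x => y / ((x - t) ^ 2 + y ^ 2) * (1 + x ^ 2))
      (Measurable.aestronglyMeasurable (by fun_prop)) (ae_of_all _ hb)).congr
      (ae_of_all _ fun x => ?_)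
    have : 1 + x ^ 2 ≠ 0 := by positivity
    simp only [Pi.smul_apply', smul_smul]
    congr 1
    field_simp
  have hc : ∫ x, (y / ((x - t) ^ 2 + y ^ 2) : ℝ) • f t = (Real.pi : ℝ) • f t := by
    rw [integral_smul_const, integral_poisson hy]
  rw [← hc, ← integral_sub hint ((integrable_poisson hy t).smul_const _)]
  refine (norm_integral_le_integral_norm _).trans_eq (integral_congr_ae (ae_of_all _ fun x => ?_))
  have : 0 ≤ y / ((x - t) ^ 2 + y ^ 2) := by positivity
  simp only [← smul_sub, norm_smul, Real.norm_eq_abs, abs_of_nonneg this]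

/-- The kernel comparing the truncated integrals with the conjugate Poisson means. -/
noncomputable def truncDiff (y s : ℝ) : ℝ :=
  {s : ℝ | y < |s|}.indicator (fun s => s⁻¹) s - s / (s ^ 2 + y ^ 2)

theorem measurable_truncDiff (y : ℝ) : Measurable (truncDiff y) := by
  have : MeasurableSet {s : ℝ | y < |s|} := measurableSet_lt measurable_const (by fun_prop)
  exact (measurable_inv.indicator this).sub (by fun_prop)

theorem truncDiff_neg (y s : ℝ) : truncDiff y (-s) = -truncDiff y s := by
  unfold truncDiff
  by_cases h : y < |s|
  · rw [indicator_of_mem (by simpa using h), indicator_of_mem (by simpa using h)]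
    rw [inv_neg, neg_div, neg_sq]; ring
  · rw [indicator_of_notMem (by simpa using h), indicator_of_notMem (by simpa using h)]
    rw [neg_div, neg_sq]; ring

theorem abs_truncDiff_le {y : ℝ} (hy : 0 < y) (s : ℝ) :
    |truncDiff y s| ≤ y / (s ^ 2 + y ^ 2) := by
  have h0 : 0 < s ^ 2 + y ^ 2 := by positivity
  unfold truncDiff
  by_cases h : y < |s|
  · rw [indicator_of_mem (by simpa using h)]
    have hs : 0 < |s| := hy.trans h
    have hs' : s ≠ 0 := abs_pos.mp hs
    have : s⁻¹ - s / (s ^ 2 + y ^ 2) = y ^ 2 / (s * (s ^ 2 + y ^ 2)) := by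
      field_simp; ring
    rw [this, abs_div, abs_mul, abs_of_pos h0, abs_of_pos (by positivity : 0 < y ^ 2),
      div_le_div_iff₀ (by positivity) h0]
    have : 0 < y * (s ^ 2 + y ^ 2) := by positivity
    nlinarith
  · rw [indicator_of_notMem (by simpa using h), zero_sub, abs_neg, abs_div, abs_of_pos h0]
    gcongr
    exact not_lt.mp h

theorem integrable_truncDiff {y : ℝ} (hy : 0 < y) (t : ℝ) :
    Integrable fun x => truncDiff y (x - t) :=
  (integrable_poisson hy t).mono'
    ((measurable_truncDiff y).comp (by fun_prop)).aestronglyMeasurable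
    (ae_of_all _ fun x => abs_truncDiff_le hy (x - t))

theorem integral_truncDiff (y t : ℝ) : ∫ x, truncDiff y (x - t) = 0 := by
  rw [integral_sub_right_eq_self (truncDiff y)]
  have h := integral_neg_eq_self (truncDiff y) volume
  simp only [truncDiff_neg, integral_neg] at h
  linarith

theorem tendsto_truncated_sub_conjPoisson {f : ℝ → ℂ} (hf : Integrable f) {t : ℝ}
    (ht : Tendsto (fun y => ∫ x, y / ((x - t) ^ 2 + y ^ 2) * ‖f x - f t‖)
      (𝓝[>] (0 : ℝ)) (𝓝 0)) :
    Tendsto (fun y => (∫ x in {x : ℝ | y < |x - t|}, f x / (x - t)) - conjPoisson f y t)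
      (𝓝[>] (0 : ℝ)) (𝓝 0) := by
  rw [tendsto_zero_iff_norm_tendsto_zero]
  refine squeeze_zero' (Eventually.of_forall fun _ => norm_nonneg _) ?_ ht
  filter_upwards [self_mem_nhdsWithin] with y hy
  have hy : 0 < y := hy
  have hm : MeasurableSet {x : ℝ | y < |x - t|} := measurableSet_lt measurable_const (by fun_prop)
  have hkey : ∀ x, (truncDiff y (x - t) : ℂ) * f x =
      {x : ℝ | y < |x - t|}.indicator (fun x => f x / (x - t)) x -
        (((x - t) / ((x - t) ^ 2 + y ^ 2) : ℝ) : ℂ) * f x := by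
    intro x
    unfold truncDiff
    by_cases h : y < |x - t|
    · rw [indicator_of_mem (by simpa using h), indicator_of_mem (by simpa using h)]
      push_cast; ring
    · rw [indicator_of_notMem (by simpa using h), indicator_of_notMem (by simpa using h)]
      push_cast; ring
  have hb : ∀ x : ℝ, ‖(truncDiff y (x - t) : ℂ)‖ ≤ y⁻¹ := fun x => by
    rw [Complex.norm_real]
    refine (abs_truncDiff_le hy _).trans ?_
    rw [div_le_iff₀ (by positivity), inv_mul_eq_div, le_div_iff₀ hy]
    nlinarith [sq_nonneg (x - t)]
  have hI1 : Integrable fun x => (truncDiff y (x - t) : ℂ) * f x :=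
    hf.bdd_mul (c := y⁻¹) (Complex.measurable_ofReal.comp
      ((measurable_truncDiff y).comp (by fun_prop))).aestronglyMeasurable (ae_of_all _ hb)
  have hI2 := integrable_conjPoisson_kernel_mul hf hy t
  have hI3 : Integrable ({x : ℝ | y < |x - t|}.indicator (fun x => f x / (x - t))) := by
    refine (hI1.add hI2).congr (ae_of_all _ fun x => ?_)
    simp only [Pi.add_apply]
    rw [hkey]; ring
  have h1 : (∫ x in {x : ℝ | y < |x - t|}, f x / (x - t)) - conjPoisson f y t =
      ∫ x, (truncDiff y (x - t) : ℂ) * (f x - f t) := by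
    have hc : Integrable fun x => (truncDiff y (x - t) : ℂ) * f t :=
      (integrable_truncDiff hy t).ofReal.mul_const _
    simp only [mul_sub]
    rw [integral_sub hI1 hc, integral_mul_const, integral_complex_ofReal, integral_truncDiff,
      Complex.ofReal_zero, zero_mul, sub_zero, conjPoisson, ← integral_indicator hm,
      ← integral_sub hI3 hI2]
    exact integral_congr_ae (ae_of_all _ fun x => (hkey x).symm)
  rw [h1]
  have hI4 : Integrable fun x => y / ((x - t) ^ 2 + y ^ 2) * ‖f x - f t‖ := by
    refine (((integrable_poisson_mul hf.norm hy t)).add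
      ((integrable_poisson hy t).mul_const ‖f t‖)).mono' ?_ (ae_of_all _ fun x => ?_)
    · exact (integrable_poisson hy t).aestronglyMeasurable.mul
        (hf.aestronglyMeasurable.sub aestronglyMeasurable_const).norm
    · have : 0 ≤ y / ((x - t) ^ 2 + y ^ 2) := by positivity
      simp only [Pi.add_apply, ← mul_add, norm_mul, norm_norm]
      rw [Real.norm_eq_abs, abs_of_nonneg this]
      gcongr
      exact norm_sub_le _ _
  refine norm_integral_le_of_norm_le hI4 (ae_of_all _ fun x => ?_)
  rw [norm_mul, Complex.norm_real]
  exact mul_le_mul_of_nonneg_right (abs_truncDiff_le hy _) (norm_nonneg _)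

/-- Poisson's formula on a horizontal line for bounded holomorphic functions. -/
theorem integral_poisson_smul_of_bounded {Φ : ℂ → ℂ}
    (hd : DifferentiableOn ℂ Φ {z | 0 < z.im}) {y M : ℝ} (hy : 0 < y)
    (hM : ∀ z : ℂ, y ≤ z.im → ‖Φ z‖ ≤ M) (x : ℝ) {s : ℝ} (hs : 0 < s) :
    ∫ t : ℝ, (s / ((t - x) ^ 2 + s ^ 2) : ℝ) • Φ (t + y * Complex.I) =
      Real.pi • Φ (x + (y + s : ℝ) * Complex.I) := by
  set z₀ : ℂ := x + (y + s : ℝ) * Complex.I with hz₀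
  set z₁ : ℂ := x + (y - s : ℝ) * Complex.I with hz₁
  have hz₀im : z₀.im = y + s := by simp [hz₀]
  have hz₀re : z₀.re = x := by simp [hz₀]
  have hz₁im : z₁.im = y - s := by simp [hz₁]
  have hz₁re : z₁.re = x := by simp [hz₁]
  have hM0 : 0 ≤ M := (norm_nonneg _).trans (hM z₀ (by linarith))
  have hopen : IsOpen {z : ℂ | 0 < z.im} := isOpen_lt continuous_const Complex.continuous_im
  set h : ℂ → ℂ := fun ζ => dslope Φ z₀ ζ / (ζ - z₁) with hh
  have hdh : DifferentiableOn ℂ h {z | y ≤ z.im} := by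
    refine DifferentiableOn.div ?_ (by fun_prop) fun ζ hζ h0 => ?_
    · refine ((Complex.differentiableOn_dslope (hopen.mem_nhds ?_)).mpr hd).mono fun ζ hζ => ?_
      · change 0 < z₀.im
        linarith
      · exact lt_of_lt_of_le hy hζ
    · have h1 : ζ.im = z₁.im := by rw [sub_eq_zero.mp h0]
      have h2 : y ≤ ζ.im := hζ
      linarith
  have hval : ∀ ζ : ℂ, ζ ≠ z₀ → h ζ = (Φ ζ - Φ z₀) / ((ζ - z₀) * (ζ - z₁)) := fun ζ hζ => by
    simp only [hh, dslope_of_ne _ hζ, slope_def_field, div_div]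
  have hbound : ∀ (ζ : ℂ) (R : ℝ), 0 < R → y ≤ ζ.im → R / 2 ≤ ‖ζ - z₀‖ → R ≤ ‖ζ - z₁‖ →
      ‖h ζ‖ ≤ 4 * M / R ^ 2 := by
    intro ζ R hR hζ h0 h1
    have hne : ζ ≠ z₀ := by
      rintro rfl
      simp at h0
      linarith
    rw [hval ζ hne, norm_div, norm_mul]
    calc _ ≤ (M + M) / (R / 2 * R) := by
          gcongr
          exact (norm_sub_le _ _).trans (add_le_add (hM _ hζ) (hM _ (by linarith)))
      _ = 4 * M / R ^ 2 := by field_simp; ring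
  have hbot : ∀ t : ℝ, h (t + y * Complex.I) =
      (((t - x) ^ 2 + s ^ 2)⁻¹ : ℝ) • (Φ (t + y * Complex.I) - Φ z₀) := by
    intro t
    have hne : (t + y * Complex.I : ℂ) ≠ z₀ := fun h => by
      have := congrArg Complex.im h
      rw [hz₀im] at this
      simp at this
      linarith
    rw [hval _ hne, div_eq_inv_mul, Complex.real_smul]
    congr 2
    simp only [hz₀, hz₁]
    push_cast
    ring_nf
    rw [Complex.I_sq]
    ring
  have hrect : ∀ R : ℝ, 2 * s ≤ R →
      ‖∫ t in (x - R)..(x + R), h (t + y * Complex.I)‖ ≤ 16 * M / R := by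
    intro R hR
    have hR0 : 0 < R := by linarith
    have hc := Complex.integral_boundary_rect_eq_zero_of_differentiableOn h
      ((x - R : ℝ) + y * Complex.I) ((x + R : ℝ) + (y + R : ℝ) * Complex.I)
      (hdh.mono fun ζ hζ => by
        have h2 := (Complex.mem_reProdIm.mp hζ).2
        simp only [Complex.add_im, Complex.ofReal_im, Complex.mul_im, Complex.ofReal_re,
          Complex.I_im, mul_one, Complex.I_re, mul_zero, add_zero, zero_add] at h2
        rw [uIcc_of_le (by linarith)] at h2
        exact h2.1)
    simp only [Complex.add_im, Complex.ofReal_im, Complex.mul_im, Complex.ofReal_re,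
      Complex.I_im, mul_one, Complex.I_re, mul_zero, add_zero, zero_add, Complex.add_re,
      Complex.mul_re, sub_zero] at hc
    have htop : ‖∫ t in (x - R)..(x + R), h (t + (y + R : ℝ) * Complex.I)‖
        ≤ 4 * M / R ^ 2 * |x + R - (x - R)| := by
      refine intervalIntegral.norm_integral_le_of_norm_le_const fun t _ => ?_
      refine hbound _ R hR0 (by simp; linarith) ?_ ?_
      · refine le_trans ?_ (Complex.abs_im_le_norm _)
        rw [Complex.sub_im, hz₀im]
        simp only [Complex.add_im, Complex.ofReal_im, Complex.mul_im, Complex.ofReal_re,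
          Complex.I_im, mul_one, Complex.I_re, mul_zero, add_zero, zero_add]
        rw [abs_of_nonneg (by linarith)]
        linarith
      · refine le_trans ?_ (Complex.abs_im_le_norm _)
        rw [Complex.sub_im, hz₁im]
        simp only [Complex.add_im, Complex.ofReal_im, Complex.mul_im, Complex.ofReal_re,
          Complex.I_im, mul_one, Complex.I_re, mul_zero, add_zero, zero_add]
        rw [abs_of_nonneg (by linarith)]
        linarith
    have hside : ∀ a : ℝ, |a - x| = R → ‖∫ v in y..(y + R), h (a + v * Complex.I)‖
        ≤ 4 * M / R ^ 2 * |y + R - y| := by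
      intro a ha
      refine intervalIntegral.norm_integral_le_of_norm_le_const fun v hv => ?_
      rw [uIoc_of_le (by linarith)] at hv
      refine hbound _ R hR0 (by simpa using hv.1.le) ?_ ?_
      · refine le_trans ?_ (Complex.abs_re_le_norm _)
        rw [Complex.sub_re, hz₀re]
        simp only [Complex.add_re, Complex.ofReal_re, Complex.mul_re, Complex.I_re, mul_zero,
          Complex.ofReal_im, Complex.I_im, sub_zero, add_zero, mul_one]
        rw [ha]
        linarith
      · refine le_trans ?_ (Complex.abs_re_le_norm _)
        rw [Complex.sub_re, hz₁re]
        simp only [Complex.add_re, Complex.ofReal_re, Complex.mul_re, Complex.I_re, mul_zero,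
          Complex.ofReal_im, Complex.I_im, sub_zero, add_zero, mul_one]
        rw [ha]
    have h1 := hside (x + R) (by simp [abs_of_pos hR0])
    have h2 := hside (x - R) (by simp [abs_of_pos hR0])
    have h3 : ∫ t in (x - R)..(x + R), h (t + y * Complex.I) =
        (∫ t in (x - R)..(x + R), h (t + (y + R : ℝ) * Complex.I)) -
        Complex.I • (∫ v in y..(y + R), h ((x + R : ℝ) + v * Complex.I)) +
        Complex.I • (∫ v in y..(y + R), h ((x - R : ℝ) + v * Complex.I)) := by
      linear_combination hc
    rw [h3]
    refine (norm_add_le _ _).trans ?_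
    refine (add_le_add (norm_sub_le _ _) le_rfl).trans ?_
    simp only [norm_smul, Complex.norm_I, one_mul]
    rw [show x + R - (x - R) = 2 * R by ring, abs_of_pos (by linarith)] at htop
    rw [show y + R - y = R by ring, abs_of_pos hR0] at h1 h2
    calc _ ≤ 4 * M / R ^ 2 * (2 * R) + 4 * M / R ^ 2 * R + 4 * M / R ^ 2 * R := by gcongr
      _ = 16 * M / R := by field_simp; ring
  have hcont : Continuous fun t : ℝ => Φ (t + y * Complex.I) := by
    refine continuous_iff_continuousAt.mpr fun t => ?_
    have h1 : ContinuousAt Φ (t + y * Complex.I) :=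
      (hd.differentiableAt (hopen.mem_nhds (by simpa using hy))).continuousAt
    exact h1.comp (f := fun t : ℝ => (t + y * Complex.I : ℂ)) (by fun_prop)
  have hΦI : Integrable fun t : ℝ => (s / ((t - x) ^ 2 + s ^ 2) : ℝ) • Φ (t + y * Complex.I) :=
    (integrable_poisson hs x).smul_bdd M hcont.aestronglyMeasurable
      (ae_of_all _ fun t => hM _ (by simp))
  have hcI : Integrable fun t : ℝ => (s / ((t - x) ^ 2 + s ^ 2) : ℝ) • Φ z₀ :=
    (integrable_poisson hs x).smul_const _
  have hsh : ∀ t : ℝ, (s : ℝ) • h (t + y * Complex.I) =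
      (s / ((t - x) ^ 2 + s ^ 2) : ℝ) • Φ (t + y * Complex.I) -
        (s / ((t - x) ^ 2 + s ^ 2) : ℝ) • Φ z₀ := fun t => by
    rw [hbot, smul_smul, div_eq_mul_inv, smul_sub]
  have hhI : Integrable fun t : ℝ => h (t + y * Complex.I) := by
    have h1 := ((hΦI.sub hcI).congr (ae_of_all _ fun t => (hsh t).symm)).smul (s⁻¹ : ℝ)
    refine h1.congr (ae_of_all _ fun t => ?_)
    simp only [Pi.smul_apply, smul_smul, inv_mul_cancel₀ hs.ne', one_smul]
  have hlim : Tendsto (fun R : ℝ => ∫ t in (x - R)..(x + R), h (t + y * Complex.I)) atTop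
      (𝓝 (∫ t : ℝ, h (t + y * Complex.I))) :=
    intervalIntegral_tendsto_integral hhI
      (tendsto_atBot_add_const_left _ x tendsto_neg_atTop_atBot)
      (tendsto_atTop_add_const_left _ x tendsto_id)
  have hlim0 : Tendsto (fun R : ℝ => ∫ t in (x - R)..(x + R), h (t + y * Complex.I)) atTop
      (𝓝 0) := by
    refine squeeze_zero_norm' (a := fun R => 16 * M / R) ?_
      (tendsto_const_nhds.div_atTop tendsto_id)
    filter_upwards [eventually_ge_atTop (2 * s)] with R hR using hrect R hR
  have hzero := tendsto_nhds_unique hlim hlim0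
  have hfin : ∫ t : ℝ, ((s / ((t - x) ^ 2 + s ^ 2) : ℝ) • Φ (t + y * Complex.I) -
      (s / ((t - x) ^ 2 + s ^ 2) : ℝ) • Φ z₀) = 0 := by
    simp only [← hsh]
    rw [integral_smul, hzero, smul_zero]
  rw [integral_sub hΦI hcI, integral_smul_const, integral_poisson hs, sub_eq_zero] at hfin
  exact hfin

/-- A bounded holomorphic function on the upper half-plane is the Poisson integral of a
function on the real line. -/
theorem exists_poisson_representation {Φ : ℂ → ℂ}
    (hd : DifferentiableOn ℂ Φ {z | 0 < z.im}) {M : ℝ} (hM : ∀ z : ℂ, 0 < z.im → ‖Φ z‖ ≤ M) :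
    ∃ g : ℝ → ℂ, Integrable (fun x => ((1 + x ^ 2)⁻¹ : ℝ) • g x) ∧
      ∀ (x s : ℝ), 0 < s → ∫ t : ℝ, (s / ((t - x) ^ 2 + s ^ 2) : ℝ) • g t =
        Real.pi • Φ (x + s * Complex.I) := by
  set d : ℝ → NNReal := fun x => Real.toNNReal (1 + x ^ 2)⁻¹ with hd_def
  have hdm : Measurable d := by fun_prop
  have hdc : ∀ x, ((d x : NNReal) : ℝ) = (1 + x ^ 2)⁻¹ := fun x =>
    Real.coe_toNNReal _ (by positivity)
  set ρ : Measure ℝ := volume.withDensity fun x => (d x : ENNReal) with hρ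
  have : IsFiniteMeasure ρ := isFiniteMeasure_withDensity_ofReal
    integrable_inv_one_add_sq.hasFiniteIntegral
  have hopen : IsOpen {z : ℂ | 0 < z.im} := isOpen_lt continuous_const Complex.continuous_im
  have hcont : ∀ y : ℝ, 0 < y → Continuous fun t : ℝ => Φ (t + y * Complex.I) := by
    refine fun y hy => continuous_iff_continuousAt.mpr fun t => ?_
    have h1 : ContinuousAt Φ (t + y * Complex.I) :=
      (hd.differentiableAt (hopen.mem_nhds (by simpa using hy))).continuousAt
    exact h1.comp (f := fun t : ℝ => (t + y * Complex.I : ℂ)) (by fun_prop)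
  have hmem : ∀ y : ℝ, 0 < y → MemLp (fun t : ℝ => Φ (t + y * Complex.I)) 2 ρ := fun y hy =>
    MemLp.of_bound (hcont y hy).aestronglyMeasurable M (ae_of_all _ fun t => hM _ (by simpa))
  set a : ℕ → ℝ := fun n => 1 / ((n : ℝ) + 1) with ha
  have ha0 : ∀ n, 0 < a n := fun n => Nat.one_div_pos_of_nat
  set u : ℕ → Lp ℂ 2 ρ := fun n => (hmem (a n) (ha0 n)).toLp _ with hu
  set C : ℝ := (measureUnivNNReal ρ : ℝ) ^ (2 : ENNReal).toReal⁻¹ * M with hC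
  have hubd : ∀ n, ‖u n‖ ≤ C := fun n => by
    have h0 : 0 ≤ M := (norm_nonneg _).trans (hM Complex.I (by simp))
    refine Lp.norm_le_of_ae_bound (f := u n) h0 (by
      filter_upwards [(hmem (a n) (ha0 n)).coeFn_toLp] with t ht
      rw [ht]
      exact hM _ (by simpa using ha0 n))
  set 𝒰 : Ultrafilter ℕ := Ultrafilter.of atTop with h𝒰
  have h𝒰le : (𝒰 : Filter ℕ) ≤ atTop := Ultrafilter.of_le atTop
  obtain ⟨L, -, hL⟩ := (WeakDual.isCompact_closedBall (𝕜 := ℂ)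
    (0 : StrongDual ℂ (Lp ℂ 2 ρ)) C).ultrafilter_le_nhds'
    (𝒰.map fun n => StrongDual.toWeakDual (InnerProductSpace.toDual ℂ (Lp ℂ 2 ρ) (u n)))
    (by
      rw [Ultrafilter.mem_map]
      refine Filter.univ_mem' fun n => ?_
      simpa using hubd n)
  set g : Lp ℂ 2 ρ := (InnerProductSpace.toDual ℂ (Lp ℂ 2 ρ)).symm (WeakDual.toStrongDual L) with hg
  have hlim : ∀ v : Lp ℂ 2 ρ, Tendsto (fun n => inner ℂ (u n) v) 𝒰 (𝓝 (inner ℂ g v)) := by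
    intro v
    have h1 := ((WeakDual.eval_continuous v).tendsto L).comp hL
    have h2 : L v = inner ℂ g v := by
      rw [hg, InnerProductSpace.toDual_symm_apply]; rfl
    rw [← h2]
    exact h1
  refine ⟨g, ?_, fun x s hs => ?_⟩
  · have h := (Lp.memLp g).integrable (by norm_num)
    refine ((integrable_withDensity_iff_integrable_smul hdm).mp h).congr (ae_of_all _ fun x => ?_)
    simp only [NNReal.smul_def, hdc]
  · set k : ℝ → ℝ := fun t => s / ((t - x) ^ 2 + s ^ 2) with hk
    set φ : ℝ → ℂ := fun t => ((k t * (1 + t ^ 2) : ℝ) : ℂ) with hφ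
    have hφm : MemLp φ 2 ρ := by
      refine MemLp.of_bound (Measurable.aestronglyMeasurable (by fun_prop))
        (2 * s + (2 * x ^ 2 + 1) / s) (ae_of_all _ fun t => ?_)
      have h0 : 0 < (t - x) ^ 2 + s ^ 2 := by positivity
      simp only [hφ, hk, Complex.norm_real, Real.norm_eq_abs]
      rw [abs_of_nonneg (by positivity), div_mul_eq_mul_div, div_le_iff₀ h0]
      have h1 : (2 * s + (2 * x ^ 2 + 1) / s) * ((t - x) ^ 2 + s ^ 2) ≥
          2 * s * (t - x) ^ 2 + (2 * x ^ 2 + 1) * s := by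
        have : (2 * x ^ 2 + 1) / s * ((t - x) ^ 2 + s ^ 2) ≥ (2 * x ^ 2 + 1) * s := by
          rw [ge_iff_le, div_mul_eq_mul_div, le_div_iff₀ hs]
          nlinarith [mul_nonneg (by positivity : 0 ≤ 2 * x ^ 2 + 1) (sq_nonneg (t - x))]
        nlinarith [pow_pos hs 3]
      nlinarith [mul_nonneg hs.le (sq_nonneg (t - 2 * x))]
    have hinner : ∀ v : Lp ℂ 2 ρ, inner ℂ v (hφm.toLp φ) =
        starRingEnd ℂ (∫ t : ℝ, k t • v t) := by
      intro v
      have h1 : ∫ t, φ t * starRingEnd ℂ (v t) ∂ρ =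
          ∫ t : ℝ, starRingEnd ℂ (k t • v t) := by
        refine (integral_withDensity_eq_integral_smul hdm _).trans
          (integral_congr_ae (ae_of_all _ fun t => ?_))
        have : 1 + t ^ 2 ≠ 0 := by positivity
        simp only [NNReal.smul_def, hdc, hφ]
        rw [Complex.real_smul, Complex.real_smul, map_mul, Complex.conj_ofReal, ← mul_assoc,
          ← Complex.ofReal_mul, mul_comm (k t), inv_mul_cancel_left₀ this]
      rw [L2.inner_def, ← integral_conj, ← h1]
      refine integral_congr_ae ?_
      filter_upwards [hφm.coeFn_toLp] with t ht
      rw [ht, RCLike.inner_apply]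
    have h2 : ∀ n, ∫ t : ℝ, k t • (u n : ℝ → ℂ) t =
        Real.pi • Φ (x + (a n + s : ℝ) * Complex.I) := by
      intro n
      rw [← integral_poisson_smul_of_bounded hd (ha0 n)
        (fun z hz => hM z ((ha0 n).trans_le hz)) x hs]
      have hac : volume ≪ ρ := withDensity_absolutelyContinuous' (by fun_prop)
        (ae_of_all _ fun t => by
          have : 0 < (1 + t ^ 2)⁻¹ := by positivity
          simpa [hd_def] using this)
      refine integral_congr_ae ?_
      filter_upwards [hac.ae_le (hmem (a n) (ha0 n)).coeFn_toLp] with t ht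
      rw [ht]
    have h3 : Tendsto (fun n => Real.pi • Φ (x + (a n + s : ℝ) * Complex.I)) atTop
        (𝓝 (Real.pi • Φ (x + s * Complex.I))) := by
      have hc : ContinuousAt Φ (x + s * Complex.I) :=
        (hd.differentiableAt (hopen.mem_nhds (by simpa using hs))).continuousAt
      refine (hc.tendsto.comp ?_).const_smul _
      have h4 : Tendsto (fun n => a n + s) atTop (𝓝 (0 + s)) :=
        tendsto_one_div_add_atTop_nhds_zero_nat.add_const s
      rw [zero_add] at h4
      exact (((Complex.continuous_ofReal.tendsto s).comp h4).mul_const _).const_add _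
    have h5 := hlim (hφm.toLp φ)
    simp only [hinner, h2] at h5
    have h6 := ((Complex.continuous_conj.tendsto _).comp h3).mono_left h𝒰le
    exact (starRingEnd ℂ).injective (tendsto_nhds_unique h5 h6)

/-- **Fatou's theorem** for vertical limits of bounded holomorphic functions on the upper
half-plane. -/
theorem ae_exists_tendsto_of_bounded {Φ : ℂ → ℂ}
    (hd : DifferentiableOn ℂ Φ {z | 0 < z.im}) {M : ℝ} (hM : ∀ z : ℂ, 0 < z.im → ‖Φ z‖ ≤ M) :
    ∀ᵐ t : ℝ, ∃ l, Tendsto (fun y : ℝ => Φ (t + y * Complex.I)) (𝓝[>] 0) (𝓝 l) := by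
  obtain ⟨g, hg, hrep⟩ := exists_poisson_representation hd hM
  filter_upwards [ae_tendsto_poisson_norm_sub hg] with t ht
  refine ⟨g t, ?_⟩
  have h := (tendsto_poisson_smul hg ht).const_smul (Real.pi⁻¹ : ℝ)
  rw [smul_smul, inv_mul_cancel₀ Real.pi_ne_zero, one_smul] at h
  refine h.congr' ?_
  filter_upwards [self_mem_nhdsWithin] with y hy
  rw [hrep t y hy, smul_smul, inv_mul_cancel₀ Real.pi_ne_zero, one_smul]

/-- A continuous function converges as soon as its complex phase does. -/
theorem exists_tendsto_of_tendsto_exp_mul_I {u : ℝ → ℝ} (hu : ContinuousOn u (Ioi 0)) {m : ℂ}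
    (hm : m ≠ 0)
    (h : Tendsto (fun y => Complex.exp (u y * Complex.I)) (𝓝[>] (0 : ℝ)) (𝓝 m)) :
    ∃ U, Tendsto u (𝓝[>] (0 : ℝ)) (𝓝 U) := by
  have hm1 : ‖m‖ = 1 := by
    refine tendsto_nhds_unique h.norm ?_
    simp only [Complex.norm_exp_ofReal_mul_I]
    exact tendsto_const_nhds
  set α := Complex.arg m with hα
  have hmα : m = Complex.exp (α * Complex.I) := by
    have := Complex.norm_mul_exp_arg_mul_I m
    rwa [hm1, Complex.ofReal_one, one_mul, eq_comm] at this
  have hv : Tendsto (fun y => Complex.exp ((u y - α : ℝ) * Complex.I)) (𝓝[>] (0 : ℝ)) (𝓝 1) := by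
    have h1 := h.mul_const m⁻¹
    rw [mul_inv_cancel₀ hm] at h1
    refine h1.congr fun y => ?_
    rw [hmα, ← Complex.exp_neg, ← Complex.exp_add]
    congr 1
    push_cast
    ring
  have hcos : ∀ᶠ y in 𝓝[>] (0 : ℝ), 0 < Real.cos (u y - α) := by
    have h1 := (Complex.continuous_re.tendsto _).comp hv
    refine (h1.eventually (lt_mem_nhds (a := 0) (by simp))).mono fun y hy => ?_
    change 0 < (Complex.exp ((u y - α : ℝ) * Complex.I)).re at hy
    rwa [Complex.exp_ofReal_mul_I_re] at hy
  obtain ⟨δ, hδ0, hδ⟩ := mem_nhdsGT_iff_exists_Ioc_subset.mp hcos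
  have hδ0 : 0 < δ := hδ0
  set k : ℤ := round ((u δ - α) / (2 * Real.pi)) with hk
  set v : ℝ → ℝ := fun y => u y - α - k * (2 * Real.pi) with hv_def
  have hcosv : ∀ y ∈ Ioc 0 δ, 0 < Real.cos (v y) := fun y hy => by
    simp only [hv_def]
    rw [Real.cos_sub_int_mul_two_pi]
    exact hδ hy
  have hvδ : |v δ| ≤ Real.pi := by
    have h1 := abs_sub_round ((u δ - α) / (2 * Real.pi))
    have h2 : v δ = ((u δ - α) / (2 * Real.pi) - k) * (2 * Real.pi) := by
      simp only [hv_def]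
      field_simp
    rw [h2, abs_mul, abs_of_pos Real.two_pi_pos]
    nlinarith [Real.pi_pos]
  have hvδ2 : |v δ| < Real.pi / 2 := by
    by_contra hcon
    have h1 := Real.cos_nonpos_of_pi_div_two_le_of_le (not_lt.mp hcon) (by linarith [Real.pi_pos])
    rw [Real.cos_abs] at h1
    exact absurd (hcosv δ ⟨hδ0, le_rfl⟩) (not_lt.mpr h1)
  have hvc : ContinuousOn v (Ioi 0) := by fun_prop
  have hall : ∀ y ∈ Ioc 0 δ, |v y| < Real.pi / 2 := by
    intro y hy
    by_contra hcon
    have hivt := intermediate_value_Icc' hy.2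
      (f := fun y => |v y|) ((hvc.mono fun z hz => lt_of_lt_of_le hy.1 hz.1).abs)
    obtain ⟨z, hz, hzv⟩ := hivt ⟨hvδ2.le, not_lt.mp hcon⟩
    have h1 := hcosv z ⟨hy.1.trans_le hz.1, hz.2⟩
    have hzv : |v z| = Real.pi / 2 := hzv
    rw [← Real.cos_abs, hzv, Real.cos_pi_div_two] at h1
    exact lt_irrefl _ h1
  have hexp : Tendsto (fun y => Complex.arg (Complex.exp ((u y - α : ℝ) * Complex.I)))
      (𝓝[>] (0 : ℝ)) (𝓝 0) := by
    have h1 : ContinuousAt Complex.arg 1 := Complex.continuousAt_arg Complex.one_mem_slitPlane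
    have := h1.tendsto.comp hv
    rwa [Complex.arg_one] at this
  have hv0 : Tendsto v (𝓝[>] (0 : ℝ)) (𝓝 0) := by
    refine hexp.congr' ?_
    filter_upwards [Ioc_mem_nhdsGT hδ0] with y hy
    have h1 : Complex.exp ((u y - α : ℝ) * Complex.I) = Complex.exp (v y * Complex.I) := by
      rw [Complex.exp_eq_exp_iff_exists_int]
      refine ⟨k, ?_⟩
      simp only [hv_def]
      push_cast
      ring
    have h2 := abs_lt.mp (hall y hy)
    rw [h1, Complex.arg_exp_mul_I, toIocMod_eq_self]
    constructor <;> linarith [Real.pi_pos]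
  refine ⟨α + k * (2 * Real.pi), ?_⟩
  have h1 := hv0.add_const (α + k * (2 * Real.pi))
  rw [zero_add] at h1
  refine h1.congr fun y => ?_
  simp only [hv_def]
  ring

theorem ae_exists_tendsto_conjPoisson_of_nonneg {f : ℝ → ℝ} (hf : Integrable f)
    (hf0 : ∀ x, 0 ≤ f x) :
    ∀ᵐ t, ∃ U : ℂ, Tendsto (fun y => conjPoisson (fun x => f x) y t) (𝓝[>] (0 : ℝ)) (𝓝 U) := by
  have hdF : DifferentiableOn ℂ (cauchyT f) {z | 0 < z.im} := fun z hz =>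
    (differentiableAt_cauchyT hf hz).differentiableWithinAt
  have hd : DifferentiableOn ℂ (fun z => Complex.exp (Complex.I * cauchyT f z))
      {z | 0 < z.im} := (hdF.const_mul _).cexp
  have hb : ∀ z : ℂ, 0 < z.im → ‖Complex.exp (Complex.I * cauchyT f z)‖ ≤ 1 := fun z hz => by
    rw [Complex.norm_exp]
    simpa using cauchyT_im_nonneg hf hf0 hz
  have hfC := integrable_inv_one_add_sq_smul (f := fun x => (f x : ℂ)) hf.ofReal
  filter_upwards [ae_exists_tendsto_of_bounded hd hb, ae_tendsto_poisson_norm_sub hfC]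
    with t ⟨l, hl⟩ ht
  set u : ℝ → ℝ := fun y => (cauchyT f (t + y * Complex.I)).re with hu
  have him : Tendsto (fun y : ℝ => (cauchyT f (t + y * Complex.I)).im) (𝓝[>] 0)
      (𝓝 (Real.pi * f t)) := by
    have h1 := (Complex.continuous_re.tendsto _).comp (tendsto_poisson_smul hfC ht)
    simp only [Complex.real_smul, ← Complex.ofReal_mul, Complex.ofReal_re] at h1
    refine h1.congr' ?_
    filter_upwards [self_mem_nhdsWithin] with y hy
    rw [cauchyT_im hf t hy, Function.comp_apply, integral_complex_ofReal, Complex.ofReal_re]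
  have hexp : Tendsto (fun y => Complex.exp (u y * Complex.I)) (𝓝[>] (0 : ℝ))
      (𝓝 (Real.exp (Real.pi * f t) * l)) := by
    have h1 := ((Complex.continuous_ofReal.tendsto _).comp
      ((Real.continuous_exp.tendsto _).comp him)).mul hl
    refine h1.congr fun y => ?_
    simp only [Function.comp_apply, Complex.ofReal_exp, ← Complex.exp_add, hu]
    congr 1
    conv_lhs => rw [← Complex.re_add_im (cauchyT f (t + y * Complex.I))]
    simp only [Complex.add_im, Complex.ofReal_im, Complex.mul_im, Complex.ofReal_re,
      Complex.I_im, Complex.I_re, mul_one, mul_zero, zero_add, add_zero]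
    ring_nf
    rw [Complex.I_sq]
    ring
  have hl0 : (Real.exp (Real.pi * f t) * l : ℂ) ≠ 0 := by
    intro h0
    rw [h0] at hexp
    have h1 := hexp.norm
    simp only [Complex.norm_exp_ofReal_mul_I, norm_zero] at h1
    exact one_ne_zero (tendsto_nhds_unique tendsto_const_nhds h1)
  have hcont : ContinuousOn u (Ioi 0) := fun y hy => by
    have h1 : ContinuousAt (cauchyT f) (t + y * Complex.I) :=
      (differentiableAt_cauchyT hf (by simpa using hy)).continuousAt
    exact (Complex.continuous_re.continuousAt.comp
      (h1.comp (f := fun y : ℝ => (t + y * Complex.I : ℂ)) (by fun_prop))).continuousWithinAt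
  obtain ⟨U, hU⟩ := exists_tendsto_of_tendsto_exp_mul_I hcont hl0 hexp
  refine ⟨U, ((Complex.continuous_ofReal.tendsto U).comp hU).congr' ?_⟩
  filter_upwards [self_mem_nhdsWithin] with y hy
  exact cauchyT_re hf t hy

/-- The positive part of the component of `f` in the direction `I ^ i`. -/
noncomputable def nonnegPart (i : Fin 4) (f : ℝ → ℂ) (x : ℝ) : ℝ :=
  max (((-Complex.I) ^ (i : ℕ) * f x).re) 0

theorem nonnegPart_nonneg (i : Fin 4) (f : ℝ → ℂ) (x : ℝ) : 0 ≤ nonnegPart i f x :=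
  le_max_right _ _

theorem nonnegPart_le (i : Fin 4) (f : ℝ → ℂ) (x : ℝ) : nonnegPart i f x ≤ ‖f x‖ := by
  refine max_le ((Complex.re_le_norm _).trans ?_) (norm_nonneg _)
  simp

theorem integrable_nonnegPart {f : ℝ → ℂ} (hf : Integrable f) (i : Fin 4) :
    Integrable (nonnegPart i f) :=
  (hf.const_mul _).re.pos_part

theorem sum_nonnegPart (f : ℝ → ℂ) (x : ℝ) :
    f x = ∑ i : Fin 4, Complex.I ^ (i : ℕ) * (nonnegPart i f x : ℂ) := by
  have h : ∀ a : ℝ, max a 0 - max (-a) 0 = a := fun a => by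
    rcases le_total 0 a with h | h <;> simp [h]
  have h2 := h (f x).re
  have h3 := h (f x).im
  simp only [Fin.sum_univ_four, nonnegPart, Fin.coe_ofNat_eq_mod]
  norm_num [pow_succ]
  apply Complex.ext
  · simp
    linarith
  · simp
    linarith

theorem conjPoisson_eq_sum {f : ℝ → ℂ} (hf : Integrable f) {y : ℝ} (hy : 0 < y) (t : ℝ) :
    conjPoisson f y t =
      ∑ i : Fin 4, Complex.I ^ (i : ℕ) * conjPoisson (fun x => nonnegPart i f x) y t := by
  simp only [conjPoisson, ← integral_const_mul]
  rw [← integral_finsetSum]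
  · refine integral_congr_ae (ae_of_all _ fun x => ?_)
    beta_reduce
    conv_lhs => rw [sum_nonnegPart f x, Finset.mul_sum]
    exact Finset.sum_congr rfl fun i _ => by ring
  · intro i _
    exact (integrable_conjPoisson_kernel_mul (integrable_nonnegPart hf i).ofReal hy t).const_mul _

theorem norm_conjPoisson_le_sum {f : ℝ → ℂ} (hf : Integrable f) {y : ℝ} (hy : 0 < y) (t : ℝ) :
    ‖conjPoisson f y t‖ ≤ ∑ i : Fin 4, ‖conjPoisson (fun x => nonnegPart i f x) y t‖ := by
  rw [conjPoisson_eq_sum hf hy]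
  refine (norm_sum_le _ _).trans (Finset.sum_le_sum fun i _ => ?_)
  simp

theorem conjPoisson_sub {f g : ℝ → ℂ} (hf : Integrable f) (hg : Integrable g) {y : ℝ}
    (hy : 0 < y) (t : ℝ) :
    conjPoisson (fun x => f x - g x) y t = conjPoisson f y t - conjPoisson g y t := by
  simp only [conjPoisson, mul_sub]
  exact integral_sub (integrable_conjPoisson_kernel_mul hf hy t)
    (integrable_conjPoisson_kernel_mul hg hy t)

theorem ae_exists_tendsto_conjPoisson {f : ℝ → ℂ} (hf : Integrable f) :
    ∀ᵐ t, ∃ U : ℂ, Tendsto (fun y => conjPoisson f y t) (𝓝[>] (0 : ℝ)) (𝓝 U) := by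
  have h := ae_all_iff.mpr fun i => ae_exists_tendsto_conjPoisson_of_nonneg
    (integrable_nonnegPart hf i) (nonnegPart_nonneg i f)
  filter_upwards [h] with t ht
  choose U hU using ht
  refine ⟨∑ i : Fin 4, Complex.I ^ (i : ℕ) * U i,
    (tendsto_finsetSum _ fun i _ => (hU i).const_mul (Complex.I ^ ((i : Fin 4) : ℕ))).congr' ?_⟩
  filter_upwards [self_mem_nhdsWithin] with y hy
  exact (conjPoisson_eq_sum hf hy t).symm

theorem setIntegral_truncated_indicator_Ioo {f : ℝ → ℂ} (hf : IntegrableOn f (Ioo (-1) 1)) {t : ℝ}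
    (ht : t ∈ Ioo (-1 : ℝ) 1) {y : ℝ} (hy : 0 < y) :
    ∫ x in {x : ℝ | y < |x - t|}, (Ioo (-1 : ℝ) 1).indicator f x / ((x : ℂ) - t) =
      (∫ x in Ioo (-1 : ℝ) (t - y), f x / ((x : ℂ) - t)) +
        ∫ x in Ioo (t + y) (1 : ℝ), f x / ((x : ℂ) - t) := by
  have hset : {x : ℝ | y < |x - t|} = Iio (t - y) ∪ Ioi (t + y) := by
    ext x
    simp only [mem_ofPred_eq, mem_union, mem_Iio, mem_Ioi, lt_abs]
    constructor
    · rintro (h | h)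
      · right; linarith
      · left; linarith
    · rintro (h | h)
      · right; linarith
      · left; linarith
  have hint : IntegrableOn (fun x : ℝ => (Ioo (-1 : ℝ) 1).indicator f x / ((x : ℂ) - t))
      {x : ℝ | y < |x - t|} := by
    have hf' := (integrable_indicator_iff measurableSet_Ioo).mpr hf
    refine Integrable.mono' (hf'.norm.div_const y).integrableOn
      ((hf'.aestronglyMeasurable.mul
        (Measurable.aestronglyMeasurable (f := fun x : ℝ => ((x : ℂ) - t)⁻¹)
        (by fun_prop))).restrict) ?_
    refine (ae_restrict_iff' (measurableSet_lt measurable_const (by fun_prop))).mpr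
      (ae_of_all _ fun x hx => ?_)
    have hx : y < |x - t| := hx
    rw [norm_div, ← Complex.ofReal_sub, Complex.norm_real, Real.norm_eq_abs]
    gcongr
  have hind : (fun x : ℝ => (Ioo (-1 : ℝ) 1).indicator f x / ((x : ℂ) - t)) =
      (Ioo (-1 : ℝ) 1).indicator fun x => f x / ((x : ℂ) - t) := by
    ext x
    by_cases hx : x ∈ Ioo (-1 : ℝ) 1 <;> simp only [hx, indicator_of_mem, indicator_of_notMem,
      not_false_eq_true, zero_div]
  rw [hset] at hint ⊢
  rw [setIntegral_union _ measurableSet_Ioi hint.left_of_union hint.right_of_union, hind,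
    setIntegral_indicator measurableSet_Ioo, setIntegral_indicator measurableSet_Ioo]
  · congr 3
    · ext x
      simp only [mem_inter_iff, mem_Iio, mem_Ioo]
      exact ⟨fun h => ⟨h.2.1, h.1⟩, fun h => ⟨h.2, h.1, by linarith [ht.2]⟩⟩
    · ext x
      simp only [mem_inter_iff, mem_Ioi, mem_Ioo]
      exact ⟨fun h => ⟨h.1, h.2.2⟩, fun h => ⟨h.1, by linarith [ht.1], h.2⟩⟩
  · exact Set.disjoint_left.mpr fun x hx hx' => by
      simp only [mem_Iio, mem_Ioi] at hx hx'
      linarith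

/-- Almost everywhere, the conjugate Poisson integral of `f` converges to `π T f`. -/
theorem ae_tendsto_conjPoisson_FHT {f : ℝ → ℂ} (hf : Integrable f mIoo) :
    ∀ᵐ t ∂mIoo, Tendsto (fun y => conjPoisson ((Ioo (-1 : ℝ) 1).indicator f) y t) (𝓝[>] (0 : ℝ))
      (𝓝 (Real.pi * FHT f t)) := by
  have hf' : Integrable ((Ioo (-1 : ℝ) 1).indicator f) :=
    (integrable_indicator_iff measurableSet_Ioo).mpr hf
  have hfC := integrable_inv_one_add_sq_smul hf'
  refine (ae_restrict_iff' measurableSet_Ioo).mpr ?_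
  filter_upwards [ae_exists_tendsto_conjPoisson hf', ae_tendsto_poisson_norm_sub hfC]
    with t ⟨U, hU⟩ ht htI
  have h1 := ((tendsto_truncated_sub_conjPoisson hf' ht).add hU).const_mul (Real.pi : ℂ)⁻¹
  have h2 : FHT f t = (Real.pi : ℂ)⁻¹ * (0 + U) := by
    refine Tendsto.limUnder_eq (h1.congr' ?_)
    filter_upwards [self_mem_nhdsWithin] with y hy
    rw [sub_add_cancel, setIntegral_truncated_indicator_Ioo hf htI hy]
  have hpi : (Real.pi : ℂ) ≠ 0 := Complex.ofReal_ne_zero.mpr Real.pi_ne_zero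
  rwa [h2, zero_add, mul_inv_cancel_left₀ hpi]

theorem continuous_conjPoisson {f : ℝ → ℂ} (hf : Integrable f) {y : ℝ} (hy : 0 < y) :
    Continuous (conjPoisson f y) := by
  refine continuous_of_dominated (bound := fun x => y⁻¹ * ‖f x‖)
    (fun t => (integrable_conjPoisson_kernel_mul hf hy t).aestronglyMeasurable)
    (fun t => ae_of_all _ fun x => ?_) (hf.norm.const_mul _) (ae_of_all _ fun x => ?_)
  · rw [norm_mul, Complex.norm_real]
    exact mul_le_mul_of_nonneg_right (abs_conjPoisson_kernel_le hy _) (norm_nonneg _)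
  · have : ∀ t : ℝ, (x - t) ^ 2 + y ^ 2 ≠ 0 := fun t => by positivity
    exact (Complex.continuous_ofReal.comp (by fun_prop (disch := exact this _))).mul_const _

theorem aestronglyMeasurable_FHT {f : ℝ → ℂ} (hf : Integrable f mIoo) :
    AEStronglyMeasurable (FHT f) mIoo := by
  have hf' : Integrable ((Ioo (-1 : ℝ) 1).indicator f) :=
    (integrable_indicator_iff measurableSet_Ioo).mpr hf
  have hpi : (Real.pi : ℂ) ≠ 0 := Complex.ofReal_ne_zero.mpr Real.pi_ne_zero
  have h : AEStronglyMeasurable (fun t => (Real.pi : ℂ) * FHT f t) mIoo :=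
    aestronglyMeasurable_of_tendsto_ae atTop
      (fun n : ℕ => (continuous_conjPoisson hf'
        (Nat.one_div_pos_of_nat (n := n) : (0 : ℝ) < 1 / (n + 1))).aestronglyMeasurable)
      ((ae_tendsto_conjPoisson_FHT hf).mono fun t ht =>
        ht.comp (tendsto_nhdsWithin_iff.mpr ⟨tendsto_one_div_add_atTop_nhds_zero_nat,
          Eventually.of_forall fun n => mem_Ioi.mpr Nat.one_div_pos_of_nat⟩))
  exact (h.const_mul (Real.pi : ℂ)⁻¹).congr (ae_of_all _ fun t => inv_mul_cancel_left₀ hpi _)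

theorem div_one_add_le_div_one_add {a b : ℝ} (ha : 0 ≤ a) (hab : a ≤ b) :
    a / (1 + a) ≤ b / (1 + b) := by
  rw [div_le_div_iff₀ (by linarith) (by linarith)]
  nlinarith

theorem sum_div_one_add_sq_le {a : Fin 4 → ℝ} (ha : ∀ i, 0 ≤ a i) :
    ((∑ i, a i) / (1 + ∑ i, a i)) ^ 2 ≤ 4 * ∑ i, (a i / (1 + a i)) ^ 2 := by
  have hs : 0 ≤ ∑ i, a i := Finset.sum_nonneg fun i _ => ha i
  have h1 : (∑ i, a i) / (1 + ∑ i, a i) ≤ ∑ i, a i / (1 + a i) := by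
    rw [Finset.sum_div]
    refine Finset.sum_le_sum fun i _ => ?_
    refine div_le_div_of_nonneg_left (ha i) (by linarith [ha i]) ?_
    linarith [Finset.single_le_sum (fun j _ => ha j) (Finset.mem_univ i)]
  calc _ ≤ (∑ i, a i / (1 + a i)) ^ 2 := pow_le_pow_left₀ (by positivity) h1 2
    _ ≤ _ := by simpa using sq_sum_le_card_mul_sum_sq (s := Finset.univ)
                  (f := fun i : Fin 4 => a i / (1 + a i))

theorem norm_add_I_ge_one {z : ℂ} (hz : 0 ≤ z.im) : 1 ≤ ‖z + Complex.I‖ := by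
  refine le_trans ?_ (Complex.im_le_norm _)
  simpa using hz

theorem norm_div_add_I_sq_le_re {z : ℂ} (hz : 0 ≤ z.im) :
    ‖z / (z + Complex.I)‖ ^ 2 ≤ (z / (z + Complex.I)).re := by
  have h1 : 0 < Complex.normSq (z + Complex.I) := by
    rw [Complex.normSq_eq_norm_sq]
    have := norm_add_I_ge_one hz
    positivity
  rw [← Complex.normSq_eq_norm_sq, map_div₀, Complex.div_re, ← add_div]
  gcongr
  simp [Complex.normSq_apply]
  nlinarith

theorem integral_conjPoisson_div_one_add_sq_le_of_nonneg {f : ℝ → ℝ} (hf : Integrable f)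
    (hf0 : ∀ x, 0 ≤ f x) {y : ℝ} (hy : 0 < y) :
    ∫ t : ℝ, (1 + t ^ 2)⁻¹ * (‖conjPoisson (fun x => f x) y t‖ /
      (1 + ‖conjPoisson (fun x => f x) y t‖)) ^ 2 ≤ Real.pi * ∫ x, f x := by
  set Φ : ℂ → ℂ := fun z => cauchyT f z / (cauchyT f z + Complex.I) with hΦ
  have him : ∀ {z : ℂ}, 0 < z.im → 0 ≤ (cauchyT f z).im := fun hz => cauchyT_im_nonneg hf hf0 hz
  have hne : ∀ {z : ℂ}, 0 < z.im → cauchyT f z + Complex.I ≠ 0 := fun hz =>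
    norm_pos_iff.mp (zero_lt_one.trans_le (norm_add_I_ge_one (him hz)))
  have hd : DifferentiableOn ℂ Φ {z | 0 < z.im} := fun z hz =>
    ((differentiableAt_cauchyT hf hz).div ((differentiableAt_cauchyT hf hz).add_const _)
      (hne hz)).differentiableWithinAt
  have hb : ∀ z : ℂ, 0 < z.im → ‖Φ z‖ ≤ 2 := fun z hz => by
    have h1 := norm_add_I_ge_one (him hz)
    have h2 := norm_sub_le (cauchyT f z + Complex.I) Complex.I
    rw [add_sub_cancel_right, Complex.norm_I] at h2
    rw [hΦ, norm_div, div_le_iff₀ (by linarith)]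
    linarith
  have hP := integral_poisson_smul_of_bounded hd hy (fun z hz => hb z (hy.trans_le hz)) 0
    one_pos
  have hcont : Continuous fun t : ℝ => Φ (t + y * Complex.I) := by
    refine continuous_iff_continuousAt.mpr fun t => ?_
    have h1 : ContinuousAt Φ (t + y * Complex.I) :=
      (hd.differentiableAt ((isOpen_lt continuous_const Complex.continuous_im).mem_nhds
        (by simpa using hy))).continuousAt
    exact h1.comp (f := fun t : ℝ => (t + y * Complex.I : ℂ)) (by fun_prop)
  have hi : Integrable fun t : ℝ => ((1 / ((t - 0) ^ 2 + 1 ^ 2) : ℝ)) • Φ (t + y * Complex.I) := by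
    exact (integrable_poisson one_pos 0).smul_bdd 2 hcont.aestronglyMeasurable
      (ae_of_all _ fun t => hb (t + y * Complex.I) (by simpa using hy))
  have hre := congrArg Complex.re hP
  rw [← RCLike.re_eq_complex_re, ← integral_re hi] at hre
  calc _ ≤ ∫ t : ℝ, RCLike.re (((1 / ((t - 0) ^ 2 + 1 ^ 2) : ℝ)) • Φ (t + y * Complex.I)) := by
        refine integral_mono_of_nonneg (ae_of_all _ fun t => by positivity) hi.re
          (ae_of_all _ fun t => ?_)
        have hz : 0 < (t + y * Complex.I : ℂ).im := by simpa using hy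
        have h1 := norm_div_add_I_sq_le_re (him hz)
        beta_reduce
        rw [RCLike.re_eq_complex_re, Complex.smul_re, smul_eq_mul, sub_zero, one_pow, one_div,
          add_comm (t ^ 2)]
        gcongr
        refine le_trans (pow_le_pow_left₀ (by positivity) ?_ 2) h1
        have h2 : ‖conjPoisson (fun x => f x) y t‖ ≤ ‖cauchyT f (t + y * Complex.I)‖ := by
          rw [← cauchyT_re hf t hy, Complex.norm_real]
          exact Complex.abs_re_le_norm _
        refine (div_one_add_le_div_one_add (norm_nonneg _) h2).trans ?_
        rw [norm_div]
        have h3 := norm_add_I_ge_one (him hz)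
        refine div_le_div_of_nonneg_left (norm_nonneg _) (by linarith) ?_
        have := norm_add_le (cauchyT f (t + y * Complex.I)) Complex.I
        rw [Complex.norm_I] at this
        linarith
    _ = Real.pi * (Φ ((0 : ℝ) + (y + 1 : ℝ) * Complex.I)).re := by
        rw [hre, RCLike.re_eq_complex_re, Complex.smul_re, smul_eq_mul]
    _ ≤ Real.pi * ∫ x, f x := by
        gcongr
        have hz : 0 < ((0 : ℝ) + (y + 1 : ℝ) * Complex.I : ℂ).im := by
          simp; linarith
        refine (Complex.re_le_norm _).trans ?_
        rw [hΦ, norm_div]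
        refine (div_le_self (norm_nonneg _) (norm_add_I_ge_one (him hz))).trans ?_
        refine (norm_cauchyT_le hf hz).trans ?_
        simp only [abs_of_nonneg (hf0 _)]
        refine div_le_self (integral_nonneg hf0) ?_
        simp; linarith

theorem integrable_conjPoisson_div_one_add_sq {f : ℝ → ℂ} (hf : Integrable f) {y : ℝ}
    (hy : 0 < y) : Integrable fun t : ℝ => (1 + t ^ 2)⁻¹ *
      (‖conjPoisson f y t‖ / (1 + ‖conjPoisson f y t‖)) ^ 2 := by
  have hc := continuous_conjPoisson hf hy
  refine integrable_inv_one_add_sq.mul_bdd (c := 1)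
    (Continuous.aestronglyMeasurable ?_) (ae_of_all _ fun t => ?_)
  · have : ∀ t, 1 + ‖conjPoisson f y t‖ ≠ 0 := fun t => by positivity
    fun_prop (disch := exact this _)
  · rw [Real.norm_of_nonneg (by positivity)]
    refine pow_le_one₀ (by positivity) ?_
    rw [div_le_one (by positivity)]
    linarith

/-- A weak form of Kolmogorov's inequality for conjugate Poisson integrals. -/
theorem integral_conjPoisson_div_one_add_sq_le {f : ℝ → ℂ} (hf : Integrable f) {y : ℝ}
    (hy : 0 < y) :
    ∫ t : ℝ, (1 + t ^ 2)⁻¹ * (‖conjPoisson f y t‖ / (1 + ‖conjPoisson f y t‖)) ^ 2 ≤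
      16 * Real.pi * ∫ x, ‖f x‖ := by
  have hp := integrable_nonnegPart hf
  calc _ ≤ ∫ t : ℝ, ∑ i : Fin 4, 4 * ((1 + t ^ 2)⁻¹ *
        (‖conjPoisson (fun x => nonnegPart i f x) y t‖ /
          (1 + ‖conjPoisson (fun x => nonnegPart i f x) y t‖)) ^ 2) := by
        refine integral_mono (integrable_conjPoisson_div_one_add_sq hf hy)
          (integrable_finsetSum _ fun i _ =>
            (integrable_conjPoisson_div_one_add_sq (hp i).ofReal hy).const_mul _) fun t => ?_
        beta_reduce
        rw [← Finset.mul_sum, ← Finset.mul_sum, mul_left_comm]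
        gcongr
        refine le_trans (pow_le_pow_left₀ (by positivity) (div_one_add_le_div_one_add
          (norm_nonneg _) (norm_conjPoisson_le_sum hf hy t)) 2)
          (sum_div_one_add_sq_le fun i => norm_nonneg _)
    _ ≤ ∑ i : Fin 4, 4 * (Real.pi * ∫ x, ‖f x‖) := by
        refine (integral_finsetSum _ fun i _ =>
          (integrable_conjPoisson_div_one_add_sq (hp i).ofReal hy).const_mul 4).trans_le ?_
        refine Finset.sum_le_sum fun i _ => ?_
        rw [integral_const_mul]
        gcongr
        refine (integral_conjPoisson_div_one_add_sq_le_of_nonneg (hp i) (nonnegPart_nonneg i f)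
          hy).trans ?_
        exact mul_le_mul_of_nonneg_left (integral_mono (hp i) hf.norm fun x =>
          nonnegPart_le i f x) Real.pi_pos.le
    _ = _ := by
        simp
        ring

theorem lintegral_FHT_div_one_add_sq_le {f : ℝ → ℂ} (hf : Integrable f mIoo) :
    ∫⁻ t, ENNReal.ofReal ((1 + t ^ 2)⁻¹ * (‖(Real.pi : ℂ) * FHT f t‖ /
      (1 + ‖(Real.pi : ℂ) * FHT f t‖)) ^ 2) ∂mIoo ≤
      ENNReal.ofReal (16 * Real.pi * ∫ x, ‖f x‖ ∂mIoo) := by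
  set f' := (Ioo (-1 : ℝ) 1).indicator f with hf'_def
  have hf' : Integrable f' := (integrable_indicator_iff measurableSet_Ioo).mpr hf
  set a : ℕ → ℝ := fun n => 1 / ((n : ℝ) + 1) with ha
  have ha0 : ∀ n, 0 < a n := fun n => Nat.one_div_pos_of_nat
  have hlim : Tendsto a atTop (𝓝[>] 0) := tendsto_nhdsWithin_iff.mpr
    ⟨tendsto_one_div_add_atTop_nhds_zero_nat, Eventually.of_forall ha0⟩
  have hnorm : ∫ x, ‖f' x‖ = ∫ x, ‖f x‖ ∂mIoo := by
    rw [mIoo, ← integral_indicator measurableSet_Ioo]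
    simp only [hf'_def, norm_indicator_eq_indicator_norm]
  set q : ℝ → ℂ → ℝ := fun t U => (1 + t ^ 2)⁻¹ * (‖U‖ / (1 + ‖U‖)) ^ 2 with hq
  have hqc : ∀ t, Continuous (q t) := fun t => by
    have : ∀ U : ℂ, 1 + ‖U‖ ≠ 0 := fun U => by positivity
    simp only [hq]
    fun_prop (disch := exact this _)
  calc _ = ∫⁻ t, liminf (fun n => ENNReal.ofReal (q t (conjPoisson f' (a n) t))) atTop ∂mIoo := by
        refine lintegral_congr_ae ?_
        filter_upwards [ae_tendsto_conjPoisson_FHT hf] with t ht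
        exact ((ENNReal.continuous_ofReal.tendsto _).comp
          (((hqc t).tendsto _).comp (ht.comp hlim))).liminf_eq.symm
    _ ≤ liminf (fun n => ∫⁻ t, ENNReal.ofReal (q t (conjPoisson f' (a n) t)) ∂mIoo) atTop :=
        lintegral_liminf_le' fun n => ((integrable_conjPoisson_div_one_add_sq hf'
          (ha0 n)).aestronglyMeasurable.aemeasurable.ennreal_ofReal).restrict
    _ ≤ _ := by
        refine liminf_le_of_le (by isBoundedDefault) fun b hb => ?_
        obtain ⟨n, hn⟩ := hb.exists
        refine hn.trans ((lintegral_mono' Measure.restrict_le_self le_rfl).trans ?_)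
        rw [← ofReal_integral_eq_lintegral_ofReal (integrable_conjPoisson_div_one_add_sq hf'
          (ha0 n)) (ae_of_all _ fun t => by positivity), ← hnorm]
        exact ENNReal.ofReal_le_ofReal (integral_conjPoisson_div_one_add_sq_le hf' (ha0 n))

theorem ae_tendsto_FHT_zero_of_summable {h : ℕ → ℝ → ℂ} (hh : ∀ k, Integrable (h k) mIoo)
    (hs : Summable fun k => ∫ x, ‖h k x‖ ∂mIoo) :
    ∀ᵐ t ∂mIoo, Tendsto (fun k => FHT (h k) t) atTop (𝓝 0) := by
  have hpi : (Real.pi : ℂ) ≠ 0 := Complex.ofReal_ne_zero.mpr Real.pi_ne_zero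
  set q : ℕ → ℝ → ENNReal := fun k t => ENNReal.ofReal ((1 + t ^ 2)⁻¹ *
    (‖(Real.pi : ℂ) * FHT (h k) t‖ / (1 + ‖(Real.pi : ℂ) * FHT (h k) t‖)) ^ 2) with hq
  have hqm : ∀ k, AEMeasurable (q k) mIoo := fun k => by
    have := (aestronglyMeasurable_FHT (hh k)).aemeasurable
    fun_prop
  have hfin : ∫⁻ t, ∑' k, q k t ∂mIoo ≠ ⊤ := by
    rw [lintegral_tsum hqm]
    refine ne_top_of_le_ne_top ?_ (ENNReal.tsum_le_tsum fun k =>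
      lintegral_FHT_div_one_add_sq_le (hh k))
    rw [← ENNReal.ofReal_tsum_of_nonneg (fun k => by positivity) (hs.mul_left _)]
    exact ENNReal.ofReal_ne_top
  filter_upwards [ae_lt_top' (AEMeasurable.tsum hqm) hfin] with t ht
  have h1 : Tendsto (fun k => (1 + t ^ 2)⁻¹ *
    (‖(Real.pi : ℂ) * FHT (h k) t‖ / (1 + ‖(Real.pi : ℂ) * FHT (h k) t‖)) ^ 2) atTop (𝓝 0) := by
    have := (ENNReal.tendsto_toReal ENNReal.zero_ne_top).comp
      (ENNReal.tendsto_atTop_zero_of_tsum_ne_top ht.ne)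
    refine this.congr fun k => ENNReal.toReal_ofReal (by positivity)
  set r : ℕ → ℝ := fun k => ‖(Real.pi : ℂ) * FHT (h k) t‖ /
    (1 + ‖(Real.pi : ℂ) * FHT (h k) t‖) with hr
  have h2 : Tendsto r atTop (𝓝 0) := by
    have h3 := (Real.continuous_sqrt.tendsto _).comp (h1.const_mul (1 + t ^ 2))
    simp only [mul_zero, Real.sqrt_zero] at h3
    refine h3.congr fun k => ?_
    have : 1 + t ^ 2 ≠ 0 := by positivity
    rw [Function.comp_apply, mul_inv_cancel_left₀ this, Real.sqrt_sq (by positivity)]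
  have h3 : Tendsto (fun k => r k / (1 - r k)) atTop (𝓝 0) := by
    have := h2.div (h2.const_sub 1) (by norm_num)
    rwa [zero_div] at this
  have h4 : Tendsto (fun k => (Real.pi : ℂ) * FHT (h k) t) atTop (𝓝 0) := by
    refine tendsto_zero_iff_norm_tendsto_zero.mpr (h3.congr fun k => ?_)
    simp only [hr]
    have : 1 + ‖(Real.pi : ℂ) * FHT (h k) t‖ ≠ 0 := by positivity
    field_simp
    simp
  have h5 := h4.const_mul (Real.pi : ℂ)⁻¹
  simp only [inv_mul_cancel_left₀ hpi, mul_zero] at h5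
  exact h5

theorem norm_conjPoisson_le {f : ℝ → ℂ} (hf : Integrable f) {y : ℝ} (hy : 0 < y) (t : ℝ) :
    ‖conjPoisson f y t‖ ≤ y⁻¹ * ∫ x, ‖f x‖ := by
  rw [← integral_const_mul]
  refine norm_integral_le_of_norm_le (hf.norm.const_mul _) (ae_of_all _ fun x => ?_)
  rw [norm_mul, Complex.norm_real]
  exact mul_le_mul_of_nonneg_right (abs_conjPoisson_kernel_le hy _) (norm_nonneg _)

theorem cauchyT_im_le_pi {f : ℝ → ℝ} (hf : Integrable f) (hf1 : ∀ x, f x ≤ 1) (t : ℝ) {y : ℝ}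
    (hy : 0 < y) : (cauchyT f (t + y * Complex.I)).im ≤ Real.pi := by
  rw [cauchyT_im hf t hy, ← integral_poisson hy t]
  refine integral_mono (integrable_poisson_mul hf hy t) (integrable_poisson hy t) fun x => ?_
  exact mul_le_of_le_one_right (by positivity) (hf1 x)

theorem integral_exp_cauchyT_re_le {f : ℝ → ℝ} (hf : Integrable f) (hf0 : ∀ x, 0 ≤ f x)
    (hf1 : ∀ x, f x ≤ 1) (hf2 : ∫ x, f x ≤ 2) {y : ℝ} (hy : 0 < y) {s : ℝ} (hs : |s| ≤ 1 / 3) :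
    Integrable (fun t : ℝ => (1 + t ^ 2)⁻¹ * Real.exp (s * (cauchyT f (t + y * Complex.I)).re)) ∧
    ∫ t : ℝ, (1 + t ^ 2)⁻¹ * Real.exp (s * (cauchyT f (t + y * Complex.I)).re) ≤
      2 * Real.pi * Real.exp (2 / 3) := by
  set Φ : ℂ → ℂ := fun z => Complex.exp (s * cauchyT f z) with hΦ
  have hd : DifferentiableOn ℂ Φ {z | 0 < z.im} := fun z hz =>
    ((differentiableAt_cauchyT hf hz).const_mul _).cexp.differentiableWithinAt
  have hb : ∀ (c : ℝ), 0 < c → ∀ z : ℂ, c ≤ z.im → ‖Φ z‖ ≤ Real.exp (1 / 3 * (2 / c)) := by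
    intro c hc z hz
    rw [hΦ, Complex.norm_exp]
    refine Real.exp_le_exp.mpr ((Complex.re_le_norm _).trans ?_)
    rw [norm_mul, Complex.norm_real]
    refine mul_le_mul hs ?_ (norm_nonneg _) (by norm_num)
    refine (norm_cauchyT_le hf (hc.trans_le hz)).trans ?_
    simp only [abs_of_nonneg (hf0 _)]
    exact div_le_div₀ (by norm_num) hf2 hc hz
  have hP := integral_poisson_smul_of_bounded hd hy (hb y hy) 0 one_pos
  have hcont : Continuous fun t : ℝ => Φ (t + y * Complex.I) := by
    refine continuous_iff_continuousAt.mpr fun t => ?_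
    have h1 : ContinuousAt Φ (t + y * Complex.I) :=
      (hd.differentiableAt ((isOpen_lt continuous_const Complex.continuous_im).mem_nhds
        (by simpa using hy))).continuousAt
    exact h1.comp (f := fun t : ℝ => (t + y * Complex.I : ℂ)) (by fun_prop)
  have hi : Integrable fun t : ℝ => ((1 / ((t - 0) ^ 2 + 1 ^ 2) : ℝ)) • Φ (t + y * Complex.I) :=
    (integrable_poisson one_pos 0).smul_bdd _ hcont.aestronglyMeasurable
      (ae_of_all _ fun t => hb y hy (t + y * Complex.I) (by simp))
  have hre := congrArg Complex.re hP
  rw [← RCLike.re_eq_complex_re, ← integral_re hi] at hre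
  have hexp : ∀ t : ℝ, Real.exp (s * (cauchyT f (t + y * Complex.I)).re) =
      ‖Φ (t + y * Complex.I)‖ := fun t => by
    rw [hΦ, Complex.norm_exp, Complex.re_ofReal_mul]
  have hi' : Integrable fun t : ℝ =>
      (1 + t ^ 2)⁻¹ * Real.exp (s * (cauchyT f (t + y * Complex.I)).re) := by
    refine hi.norm.congr (ae_of_all _ fun t => ?_)
    beta_reduce
    rw [hexp, norm_smul, Real.norm_of_nonneg (by positivity), sub_zero, one_pow, one_div,
      add_comm]
  refine ⟨hi', ?_⟩
  calc _ ≤ ∫ t : ℝ, 2 * RCLike.re (((1 / ((t - 0) ^ 2 + 1 ^ 2) : ℝ)) • Φ (t + y * Complex.I)) := by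
        refine integral_mono hi' (hi.re.const_mul 2) fun t => ?_
        beta_reduce
        rw [RCLike.re_eq_complex_re, Complex.smul_re, smul_eq_mul, sub_zero, one_pow, one_div,
          add_comm (t ^ 2), mul_left_comm]
        gcongr
        rw [hΦ, Complex.exp_re, Complex.re_ofReal_mul, Complex.im_ofReal_mul]
        have h0 := cauchyT_im_nonneg hf hf0 (z := t + y * Complex.I) (by simpa using hy)
        have h1 := cauchyT_im_le_pi hf hf1 t hy
        have h2 : 1 / 2 ≤ Real.cos (s * (cauchyT f (t + y * Complex.I)).im) := by
          rw [← Real.cos_abs, ← Real.cos_pi_div_three]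
          refine Real.cos_le_cos_of_nonneg_of_le_pi (abs_nonneg _) (by linarith [Real.pi_pos]) ?_
          rw [abs_mul, abs_of_nonneg h0]
          calc _ ≤ 1 / 3 * Real.pi := mul_le_mul hs h1 h0 (by norm_num)
            _ = _ := by ring
        nlinarith [Real.exp_pos (s * (cauchyT f (t + y * Complex.I)).re)]
    _ = 2 * (Real.pi * (Φ ((0 : ℝ) + (y + 1 : ℝ) * Complex.I)).re) := by
        rw [integral_const_mul, hre, RCLike.re_eq_complex_re, Complex.smul_re, smul_eq_mul]
    _ ≤ 2 * Real.pi * Real.exp (2 / 3) := by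
        rw [mul_assoc]
        gcongr
        refine (Complex.re_le_norm _).trans ((hb 1 one_pos _ ?_).trans_eq ?_)
        · simp [hy.le]
        · norm_num

theorem integral_exp_conjPoisson_le_of_nonneg {f : ℝ → ℝ} (hf : Integrable f)
    (hf0 : ∀ x, 0 ≤ f x) (hf1 : ∀ x, f x ≤ 1) (hf2 : ∫ x, f x ≤ 2) {y : ℝ} (hy : 0 < y) :
    ∫ t : ℝ, (1 + t ^ 2)⁻¹ * Real.exp (‖conjPoisson (fun x => f x) y t‖ / 3) ≤
      4 * Real.pi * Real.exp (2 / 3) := by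
  obtain ⟨hi1, h1⟩ := integral_exp_cauchyT_re_le hf hf0 hf1 hf2 hy (s := 1 / 3)
    (by norm_num [abs_of_pos])
  obtain ⟨hi2, h2⟩ := integral_exp_cauchyT_re_le hf hf0 hf1 hf2 hy (s := -(1 / 3))
    (by norm_num [abs_of_pos])
  have h3 := integral_mono_of_nonneg (ae_of_all _ fun t : ℝ => by positivity) (hi1.add hi2)
    (f := fun t : ℝ => (1 + t ^ 2)⁻¹ * Real.exp (‖conjPoisson (fun x => f x) y t‖ / 3))
    (ae_of_all _ fun t => by
      beta_reduce
      rw [Pi.add_apply, ← mul_add, ← cauchyT_re hf t hy, Complex.norm_real, Real.norm_eq_abs]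
      gcongr
      rcases abs_cases (cauchyT f (t + y * Complex.I)).re with ⟨h, -⟩ | ⟨h, -⟩ <;> rw [h]
      · rw [div_eq_inv_mul, ← one_div]
        linarith [Real.exp_pos (-(1 / 3) * (cauchyT f (t + y * Complex.I)).re)]
      · rw [neg_div, div_eq_inv_mul, ← one_div, ← neg_mul]
        linarith [Real.exp_pos (1 / 3 * (cauchyT f (t + y * Complex.I)).re)])
  rw [integral_add' hi1 hi2] at h3
  linarith

theorem integrable_one_add_sq_inv_mul_exp_conjPoisson {f : ℝ → ℂ} (hf : Integrable f) {y : ℝ}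
    (hy : 0 < y) (c : ℝ) :
    Integrable fun t : ℝ => (1 + t ^ 2)⁻¹ * Real.exp (‖conjPoisson f y t‖ / c) := by
  have hc := continuous_conjPoisson hf hy
  refine integrable_inv_one_add_sq.mul_bdd (c := Real.exp ((y⁻¹ * ∫ x, ‖f x‖) / |c|))
    (Continuous.aestronglyMeasurable (by fun_prop)) (ae_of_all _ fun t => ?_)
  rw [Real.norm_of_nonneg (by positivity)]
  refine Real.exp_le_exp.mpr ((le_abs_self _).trans ?_)
  rw [abs_div, abs_norm]
  gcongr
  exact norm_conjPoisson_le hf hy t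

theorem integrable_exp_conjPoisson {f : ℝ → ℂ} (hf : Integrable f) {y : ℝ}
    (hy : 0 < y) (c : ℝ) :
    Integrable (fun t : ℝ => Real.exp (‖conjPoisson f y t‖ / c)) mIoo := by
  have hc := continuous_conjPoisson hf hy
  exact (Continuous.integrableOn_Icc (by fun_prop)).mono_set Ioo_subset_Icc_self

/-- Conjugate Poisson integrals of functions bounded by one are uniformly exponentially
integrable. -/
theorem integral_exp_conjPoisson_le {f : ℝ → ℂ} (hf : Integrable f)
    (hf1 : ∀ x, ‖f x‖ ≤ 1) (hf2 : ∫ x, ‖f x‖ ≤ 2) {y : ℝ} (hy : 0 < y) :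
    ∫ t, Real.exp (‖conjPoisson f y t‖ / 12) ∂mIoo ≤ 32 * Real.pi * Real.exp (2 / 3) := by
  have hp := integrable_nonnegPart hf
  have hi := fun i => integrable_one_add_sq_inv_mul_exp_conjPoisson (hp i).ofReal hy 3
  calc _ ≤ ∫ t, 2 * ((1 + t ^ 2)⁻¹ * Real.exp (‖conjPoisson f y t‖ / 12)) ∂mIoo := by
        refine integral_mono_ae (integrable_exp_conjPoisson hf hy 12)
          ((integrable_one_add_sq_inv_mul_exp_conjPoisson hf hy 12).integrableOn.const_mul 2)
          ((ae_restrict_iff' measurableSet_Ioo).mpr (ae_of_all _ fun t ht => ?_))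
        beta_reduce
        rw [← mul_assoc]
        refine le_mul_of_one_le_left (Real.exp_pos _).le ?_
        rw [← div_eq_mul_inv, one_le_div (by positivity)]
        nlinarith [ht.1, ht.2]
    _ = 2 * ∫ t, ((1 + t ^ 2)⁻¹ * Real.exp (‖conjPoisson f y t‖ / 12)) ∂mIoo :=
        integral_const_mul _ _
    _ ≤ 2 * ∫ t, ((1 + t ^ 2)⁻¹ * Real.exp (‖conjPoisson f y t‖ / 12)) := by
        exact mul_le_mul_of_nonneg_left (setIntegral_le_integral
          (integrable_one_add_sq_inv_mul_exp_conjPoisson hf hy 12)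
          (ae_of_all _ fun t => by positivity)) zero_le_two
    _ ≤ 2 * ∫ t : ℝ, ∑ i : Fin 4, (1 + t ^ 2)⁻¹ *
          Real.exp (‖conjPoisson (fun x => nonnegPart i f x) y t‖ / 3) := by
        refine mul_le_mul_of_nonneg_left (integral_mono
          (integrable_one_add_sq_inv_mul_exp_conjPoisson hf hy 12)
          (integrable_finsetSum _ fun i _ => hi i) fun t => ?_) zero_le_two
        beta_reduce
        rw [← Finset.mul_sum]
        gcongr
        obtain ⟨i, -, h⟩ := Finset.exists_le_of_sum_le (s := (Finset.univ : Finset (Fin 4)))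
          Finset.univ_nonempty (f := fun _ => ‖conjPoisson f y t‖ / 4)
          (g := fun i => ‖conjPoisson (fun x => nonnegPart i f x) y t‖) (by
            simpa [mul_div_cancel₀] using norm_conjPoisson_le_sum hf hy t)
        refine le_trans (Real.exp_le_exp.mpr ?_) (Finset.single_le_sum (f := fun i : Fin 4 =>
          Real.exp (‖conjPoisson (fun x => nonnegPart i f x) y t‖ / 3))
          (fun j _ => (Real.exp_pos _).le) (Finset.mem_univ i))
        linarith
    _ ≤ 2 * ∑ i : Fin 4, 4 * Real.pi * Real.exp (2 / 3) := by
        refine mul_le_mul_of_nonneg_left ((integral_finsetSum _ fun i _ => hi i).trans_le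
          (Finset.sum_le_sum fun i _ => ?_)) zero_le_two
        refine integral_exp_conjPoisson_le_of_nonneg (hp i) (nonnegPart_nonneg i f)
          (fun x => (nonnegPart_le i f x).trans (hf1 x)) ?_ hy
        exact (integral_mono (hp i) hf.norm fun x => nonnegPart_le i f x).trans hf2
    _ = _ := by
        simp
        ring

/-- The conjugate Poisson operator is antisymmetric. -/
theorem integral_mul_conjPoisson {f g : ℝ → ℂ} (hf : Integrable f) (hg : Integrable g) {y : ℝ}
    (hy : 0 < y) :
    ∫ t, f t * conjPoisson g y t = -∫ t, g t * conjPoisson f y t := by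
  simp only [conjPoisson, ← integral_const_mul]
  rw [integral_integral_swap, ← integral_neg]
  · refine integral_congr_ae (ae_of_all _ fun x => ?_)
    beta_reduce
    rw [← integral_neg]
    refine integral_congr_ae (ae_of_all _ fun t => ?_)
    beta_reduce
    rw [← neg_sub t x, neg_sq, neg_div]
    push_cast
    ring
  · have h := (hf.mul_prod hg).bdd_mul (c := y⁻¹)
      (f := fun p : ℝ × ℝ => (((p.2 - p.1) / ((p.2 - p.1) ^ 2 + y ^ 2) : ℝ) : ℂ))
      (Measurable.aestronglyMeasurable (by fun_prop)) (ae_of_all _ fun p => by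
        rw [Complex.norm_real]
        exact abs_conjPoisson_kernel_le hy _)
    refine h.congr (ae_of_all _ fun p => ?_)
    simp only [Function.uncurry]
    ring

instance isFiniteMeasure_mIoo : IsFiniteMeasure mIoo := by
  unfold mIoo
  infer_instance

theorem eLpNorm_indicator_one_le_iff {α : Type*} [MeasurableSpace α] {μ : Measure α} {f : α → ℂ}
    (hf : Integrable f μ) {s : Set α} (hs : MeasurableSet s) {ε : ℝ} (hε : 0 ≤ ε) :
    eLpNorm (s.indicator f) 1 μ ≤ ENNReal.ofReal ε ↔ ∫ x in s, ‖f x‖ ∂μ ≤ ε := by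
  rw [eLpNorm_indicator_eq_eLpNorm_restrict hs, eLpNorm_one_eq_lintegral_enorm,
    ← ofReal_integral_norm_eq_lintegral_enorm hf.integrableOn, ENNReal.ofReal_le_ofReal_iff hε]

theorem exists_setIntegral_norm_le {α : Type*} [MeasurableSpace α] {μ : Measure α} {f : α → ℂ}
    (hf : Integrable f μ) {ε : ℝ} (hε : 0 < ε) :
    ∃ δ : ℝ, 0 < δ ∧ ∀ s, MeasurableSet s → μ s ≤ ENNReal.ofReal δ →
      ∫ x in s, ‖f x‖ ∂μ ≤ ε := by
  obtain ⟨δ, hδ, h⟩ := (memLp_one_iff_integrable.mpr hf).eLpNorm_indicator_le le_rfl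
    ENNReal.one_ne_top hε
  exact ⟨δ, hδ, fun s hs hμs => (eLpNorm_indicator_one_le_iff hf hs hε.le).mp (h s hs hμs)⟩

/-- **Vitali's theorem** for integrals. -/
theorem integrable_and_tendsto_integral_of_vitali {α : Type*} [MeasurableSpace α]
    {μ : Measure α} [IsFiniteMeasure μ] {u : ℕ → α → ℂ} {v : α → ℂ} {C : ℝ}
    (hu : ∀ n, Integrable (u n) μ) (hC : ∀ n, ∫ x, ‖u n x‖ ∂μ ≤ C)
    (hac : ∀ ε : ℝ, 0 < ε → ∃ δ : ℝ, 0 < δ ∧ ∀ n s, MeasurableSet s → μ s ≤ ENNReal.ofReal δ →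
      ∫ x in s, ‖u n x‖ ∂μ ≤ ε)
    (hlim : ∀ᵐ x ∂μ, Tendsto (fun n => u n x) atTop (𝓝 (v x))) :
    Integrable v μ ∧ Tendsto (fun n => ∫ x, u n x ∂μ) atTop (𝓝 (∫ x, v x ∂μ)) := by
  have hui : UnifIntegrable u 1 μ := fun ε hε => by
    obtain ⟨δ, hδ, h⟩ := hac ε hε
    exact ⟨δ, hδ, fun n s hs hμs =>
      (eLpNorm_indicator_one_le_iff (hu n) hs hε.le).mpr (h n s hs hμs)⟩
  have hUI : UniformIntegrable u 1 μ := by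
    refine ⟨fun n => (hu n).aestronglyMeasurable, hui, C.toNNReal, fun n => ?_⟩
    rw [eLpNorm_one_eq_lintegral_enorm, ← ofReal_integral_norm_eq_lintegral_enorm (hu n)]
    exact ENNReal.ofReal_le_ofReal (hC n)
  have hv := hUI.integrable_of_ae_tendsto hlim
  refine ⟨hv, tendsto_integral_of_L1' v hv.aestronglyMeasurable (Eventually.of_forall hu) ?_⟩
  exact tendsto_Lp_finite_of_tendsto_ae le_rfl ENNReal.one_ne_top
    (fun n => (hu n).aestronglyMeasurable) (memLp_one_iff_integrable.mpr hv) hui hlim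

theorem MemLlogL.integrable {g : ℝ → ℂ} (hg : MemLlogL g) : Integrable g mIoo := by
  refine (hg.2.const_mul (Real.log 2)⁻¹).mono' hg.1 (ae_of_all _ fun x => ?_)
  have h2 : 0 < Real.log 2 := Real.log_pos one_lt_two
  rw [inv_mul_eq_div, le_div_iff₀ h2]
  gcongr
  linarith [norm_nonneg (g x)]

theorem MemLlogL.indicator {g : ℝ → ℂ} (hg : MemLlogL g) {A : Set ℝ} (hA : MeasurableSet A) :
    MemLlogL (A.indicator g) := by
  refine ⟨hg.1.indicator hA, hg.2.mono' ?_ (ae_of_all _ fun x => ?_)⟩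
  · have := (hg.1.indicator hA).aemeasurable
    exact AEMeasurable.aestronglyMeasurable (by fun_prop)
  · have h1 : ‖A.indicator g x‖ ≤ ‖g x‖ := norm_indicator_le_norm_self _ _
    have h2 : 0 ≤ Real.log (2 + ‖A.indicator g x‖) :=
      Real.log_nonneg (by linarith [norm_nonneg (A.indicator g x)])
    rw [Real.norm_of_nonneg (mul_nonneg (norm_nonneg _) h2)]
    gcongr

theorem memLlogL_of_bounded {g : ℝ → ℂ} (hg : AEStronglyMeasurable g mIoo) {N : ℝ}
    (hN : ∀ x, ‖g x‖ ≤ N) : MemLlogL g := by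
  refine ⟨hg, Integrable.of_bound (C := N * Real.log (2 + N)) ?_ (ae_of_all _ fun x => ?_)⟩
  · have := hg.aemeasurable
    exact AEMeasurable.aestronglyMeasurable (by fun_prop)
  · have h2 : 0 ≤ Real.log (2 + ‖g x‖) := Real.log_nonneg (by linarith [norm_nonneg (g x)])
    have h0 := (norm_nonneg _).trans (hN x)
    rw [Real.norm_of_nonneg (mul_nonneg (norm_nonneg _) h2)]
    have := hN x
    gcongr

theorem mul_le_llogl_add_exp {a b M : ℝ} (ha : 0 ≤ a) (hb : 0 ≤ b) (hM : 0 < M) :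
    a * b ≤ 48 * (a * Real.log (2 + a)) + 48 * (M + Real.exp (b / 12) / M) := by
  have hlog : 0 ≤ Real.log (2 + a) := Real.log_nonneg (by linarith)
  rcases le_total b (48 * Real.log (2 + a)) with h | h
  · have : 0 ≤ 48 * (M + Real.exp (b / 12) / M) := by positivity
    nlinarith
  · have h1 : a ≤ Real.exp (b / 48) := by
      have : 2 + a ≤ Real.exp (b / 48) := by
        rw [← Real.log_le_iff_le_exp (by linarith)]
        linarith
      linarith
    have h2 : b ≤ 48 * Real.exp (b / 48) := by
      linarith [Real.add_one_le_exp (b / 48)]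
    have h3 : a * b ≤ 48 * Real.exp (b / 24) := by
      calc a * b ≤ Real.exp (b / 48) * (48 * Real.exp (b / 48)) :=
            mul_le_mul h1 h2 hb (Real.exp_pos _).le
        _ = 48 * (Real.exp (b / 48) * Real.exp (b / 48)) := by ring
        _ = _ := by rw [← Real.exp_add]; ring_nf
    have h4 : Real.exp (b / 24) ≤ M + Real.exp (b / 12) / M := by
      have h5 : Real.exp (b / 12) = Real.exp (b / 24) * Real.exp (b / 24) := by
        rw [← Real.exp_add]; ring_nf
      rw [h5, ← sub_le_iff_le_add', le_div_iff₀ hM]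
      nlinarith [sq_nonneg (Real.exp (b / 24) - M), Real.exp_pos (b / 24)]
    have : 0 ≤ 48 * (a * Real.log (2 + a)) := by positivity
    linarith

theorem integrable_mul_conjPoisson {g h : ℝ → ℂ} {μ : Measure ℝ} (hg : Integrable g μ)
    (hh : Integrable h) {y : ℝ} (hy : 0 < y) : Integrable (fun t => g t * conjPoisson h y t) μ :=
  hg.mul_bdd (continuous_conjPoisson hh hy).aestronglyMeasurable
    (ae_of_all _ (norm_conjPoisson_le hh hy))

/-- The class of test functions for duality: integrable functions bounded by one with
`L¹` norm at most two. -/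
structure IsUnitBounded (h : ℝ → ℂ) : Prop where
  integrable : Integrable h
  norm_le_one : ∀ x, ‖h x‖ ≤ 1
  integral_norm_le_two : ∫ x, ‖h x‖ ≤ 2

theorem isUnitBounded_of_support {h : ℝ → ℂ} (hm : AEStronglyMeasurable h)
    (h1 : ∀ x, ‖h x‖ ≤ (Ioo (-1 : ℝ) 1).indicator (fun _ => 1) x) : IsUnitBounded h := by
  have hi : Integrable ((Ioo (-1 : ℝ) 1).indicator fun _ => (1 : ℝ)) :=
    (integrable_indicator_iff measurableSet_Ioo).mpr (integrable_const (μ := mIoo) (1 : ℝ))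
  have hh : Integrable h := hi.mono' hm (ae_of_all _ h1)
  refine ⟨hh, fun x => (h1 x).trans (indicator_le_self' (fun _ _ => zero_le_one) x), ?_⟩
  refine (integral_mono hh.norm hi h1).trans ?_
  rw [integral_indicator measurableSet_Ioo, setIntegral_const]
  norm_num

theorem setIntegral_norm_mul_conjPoisson_le {g h : ℝ → ℂ} (hg : MemLlogL g)
    (hh : IsUnitBounded h) {y : ℝ} (hy : 0 < y) {M : ℝ} (hM : 0 < M) (s : Set ℝ) :
    ∫ t in s, ‖g t * conjPoisson h y t‖ ∂mIoo ≤
      48 * (∫ t in s, ‖g t‖ * Real.log (2 + ‖g t‖) ∂mIoo) +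
        48 * (M * mIoo.real s + 32 * Real.pi * Real.exp (2 / 3) / M) := by
  have hexp := (integrable_exp_conjPoisson hh.integrable hy 12)
  have hi2 : Integrable (fun t => 48 * (M + Real.exp (‖conjPoisson h y t‖ / 12) / M)) mIoo :=
    ((integrable_const M).add (hexp.div_const M)).const_mul 48
  calc _ ≤ ∫ t in s, (48 * (‖g t‖ * Real.log (2 + ‖g t‖)) +
        48 * (M + Real.exp (‖conjPoisson h y t‖ / 12) / M)) ∂mIoo := by
        refine integral_mono (integrable_mul_conjPoisson hg.integrable
          hh.integrable hy).norm.integrableOn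
          ((hg.2.const_mul 48).add hi2).integrableOn fun t => ?_
        beta_reduce
        rw [norm_mul]
        exact mul_le_llogl_add_exp (norm_nonneg _) (norm_nonneg _) hM
    _ = 48 * (∫ t in s, ‖g t‖ * Real.log (2 + ‖g t‖) ∂mIoo) + 48 * (M * mIoo.real s +
          (∫ t in s, Real.exp (‖conjPoisson h y t‖ / 12) ∂mIoo) / M) := by
        rw [integral_add (hg.2.const_mul 48).integrableOn hi2.integrableOn, integral_const_mul,
          integral_const_mul, integral_add (integrable_const M) (hexp.div_const M).integrableOn,
          integral_div, setIntegral_const, smul_eq_mul, mul_comm M]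
    _ ≤ _ := by
        have h1 : ∫ t in s, Real.exp (‖conjPoisson h y t‖ / 12) ∂mIoo ≤
            32 * Real.pi * Real.exp (2 / 3) :=
          (setIntegral_le_integral hexp (ae_of_all _ fun t => (Real.exp_pos _).le)).trans
            (integral_exp_conjPoisson_le hh.integrable hh.norm_le_one
              hh.integral_norm_le_two hy)
        gcongr

theorem exists_setIntegral_norm_mul_conjPoisson_le {g : ℝ → ℂ} (hg : MemLlogL g) {ε : ℝ}
    (hε : 0 < ε) :
    ∃ δ : ℝ, 0 < δ ∧ ∀ s, MeasurableSet s → mIoo s ≤ ENNReal.ofReal δ → ∀ h, IsUnitBounded h →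
      ∀ y : ℝ, 0 < y → ∫ t in s, ‖g t * conjPoisson h y t‖ ∂mIoo ≤ ε := by
  set K := 32 * Real.pi * Real.exp (2 / 3) with hK
  have hK0 : 0 < K := by positivity
  obtain ⟨δ, hδ, hδs⟩ := exists_setIntegral_norm_le
    (f := fun t => ((‖g t‖ * Real.log (2 + ‖g t‖) : ℝ) : ℂ)) hg.2.ofReal
    (show 0 < ε / (3 * 48) by positivity)
  set M := 3 * 48 * K / ε with hM_def
  have hM : 0 < M := by positivity
  refine ⟨min δ (ε / (3 * 48 * M)), by positivity, fun s hs hμs h hh y hy => ?_⟩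
  refine (setIntegral_norm_mul_conjPoisson_le hg hh hy hM s).trans ?_
  have h1 := hδs s hs (hμs.trans (ENNReal.ofReal_le_ofReal (min_le_left _ _)))
  have h2 : ∫ t in s, ‖g t‖ * Real.log (2 + ‖g t‖) ∂mIoo ≤ ε / (3 * 48) := by
    refine le_trans (le_of_eq (integral_congr_ae (ae_of_all _ fun t => ?_))) h1
    have h2 : 0 ≤ Real.log (2 + ‖g t‖) := Real.log_nonneg (by linarith [norm_nonneg (g t)])
    beta_reduce
    rw [Complex.norm_real, Real.norm_of_nonneg (by positivity)]
  have h3 : mIoo.real s ≤ ε / (3 * 48 * M) :=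
    ENNReal.toReal_le_of_le_ofReal (by positivity)
      (hμs.trans (ENNReal.ofReal_le_ofReal (min_le_right _ _)))
  have h4 : K / M = ε / (3 * 48) := by
    rw [hM_def]
    field_simp
  have h5 : M * mIoo.real s ≤ ε / (3 * 48) := by
    refine (mul_le_mul_of_nonneg_left h3 hM.le).trans_eq ?_
    field_simp
  rw [h4]
  linarith

theorem exists_integral_norm_mul_conjPoisson_le {g : ℝ → ℂ} (hg : MemLlogL g) :
    ∃ C : ℝ, ∀ h, IsUnitBounded h → ∀ y : ℝ, 0 < y →
      ∫ t, ‖g t * conjPoisson h y t‖ ∂mIoo ≤ C := by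
  refine ⟨48 * (∫ t, ‖g t‖ * Real.log (2 + ‖g t‖) ∂mIoo) +
    48 * (1 * mIoo.real univ + 32 * Real.pi * Real.exp (2 / 3) / 1), fun h hh y hy => ?_⟩
  simpa only [setIntegral_univ] using setIntegral_norm_mul_conjPoisson_le hg hh hy one_pos univ

theorem exists_setIntegral_norm_conjPoisson_le_dual {f : ℝ → ℂ} (hf : Integrable f) {y : ℝ}
    (hy : 0 < y) {s : Set ℝ} (hs : MeasurableSet s) :
    ∃ σ : ℝ → ℂ, IsUnitBounded σ ∧
      (∀ x, ‖σ x‖ ≤ (s ∩ Ioo (-1 : ℝ) 1).indicator (fun _ => 1) x) ∧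
      ∫ t in s, ‖conjPoisson f y t‖ ∂mIoo ≤ ∫ t, ‖f t * conjPoisson σ y t‖ := by
  have hsI := hs.inter (measurableSet_Ioo (a := (-1 : ℝ)) (b := 1))
  set U := conjPoisson f y with hU
  have hUc : Continuous U := continuous_conjPoisson hf hy
  set σ := (s ∩ Ioo (-1 : ℝ) 1).indicator
    (fun t => starRingEnd ℂ (U t) / (‖U t‖ : ℂ)) with hσ
  have hσm : Measurable σ := by
    refine Measurable.indicator ?_ hsI
    exact (Complex.continuous_conj.measurable.comp hUc.measurable).div
      (Complex.measurable_ofReal.comp hUc.measurable.norm)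
  have hσ1 : ∀ x, ‖σ x‖ ≤ (s ∩ Ioo (-1 : ℝ) 1).indicator (fun _ => 1) x := fun x => by
    rw [hσ, norm_indicator_eq_indicator_norm]
    refine indicator_le_indicator ?_
    rw [norm_div, RCLike.norm_conj, Complex.norm_real, norm_norm]
    exact div_self_le_one _
  have hσu : IsUnitBounded σ := isUnitBounded_of_support hσm.aestronglyMeasurable fun x =>
    (hσ1 x).trans (indicator_le_indicator_of_subset inter_subset_right
      (fun _ => zero_le_one) x)
  refine ⟨σ, hσu, hσ1, ?_⟩
  have h1 : ((∫ t in s, ‖U t‖ ∂mIoo : ℝ) : ℂ) = ∫ t, σ t * conjPoisson f y t := by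
    rw [← integral_complex_ofReal, mIoo, Measure.restrict_restrict hs, ← integral_indicator hsI]
    refine integral_congr_ae (ae_of_all _ fun t => ?_)
    simp only [hσ]
    by_cases ht : t ∈ s ∩ Ioo (-1 : ℝ) 1
    · rw [indicator_of_mem ht, indicator_of_mem ht, ← hU, div_mul_eq_mul_div, mul_comm,
        Complex.mul_conj, Complex.normSq_eq_norm_sq]
      by_cases h0 : U t = 0
      · simp [h0]
      · have : (‖U t‖ : ℂ) ≠ 0 := by simpa using h0
        push_cast
        field_simp
    · rw [indicator_of_notMem ht, indicator_of_notMem ht, zero_mul]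
  rw [integral_mul_conjPoisson hσu.integrable hf hy] at h1
  calc ∫ t in s, ‖U t‖ ∂mIoo ≤ ‖((∫ t in s, ‖U t‖ ∂mIoo : ℝ) : ℂ)‖ := by
        rw [Complex.norm_real]
        exact Real.le_norm_self _
    _ ≤ _ := by
        rw [h1, norm_neg]
        exact norm_integral_le_integral_norm _

theorem integral_indicator_Ioo_mul (g u : ℝ → ℂ) :
    ∫ t, (Ioo (-1 : ℝ) 1).indicator g t * u t = ∫ t, g t * u t ∂mIoo := by
  rw [mIoo, ← integral_indicator measurableSet_Ioo]
  refine integral_congr_ae (ae_of_all _ fun t => ?_)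
  exact (indicator_mul_left _ _ _).symm

theorem integral_norm_indicator_Ioo_mul (g u : ℝ → ℂ) :
    ∫ t, ‖(Ioo (-1 : ℝ) 1).indicator g t * u t‖ = ∫ t, ‖g t * u t‖ ∂mIoo := by
  rw [mIoo, ← integral_indicator measurableSet_Ioo]
  refine integral_congr_ae (ae_of_all _ fun t => ?_)
  beta_reduce
  rw [← indicator_mul_left, norm_indicator_eq_indicator_norm]

theorem exists_integral_norm_conjPoisson_le {g : ℝ → ℂ} (hg : MemLlogL g) :
    ∃ C : ℝ, ∀ y : ℝ, 0 < y →
      ∫ t, ‖conjPoisson ((Ioo (-1 : ℝ) 1).indicator g) y t‖ ∂mIoo ≤ C := by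
  obtain ⟨C, hC⟩ := exists_integral_norm_mul_conjPoisson_le hg
  refine ⟨C, fun y hy => ?_⟩
  have hg' := (integrable_indicator_iff measurableSet_Ioo).mpr hg.integrable
  obtain ⟨σ, hσ, -, h⟩ := exists_setIntegral_norm_conjPoisson_le_dual hg' hy MeasurableSet.univ
  rw [setIntegral_univ, integral_norm_indicator_Ioo_mul] at h
  exact h.trans (hC σ hσ y hy)

theorem exists_setIntegral_norm_conjPoisson_le {g : ℝ → ℂ} (hg : MemLlogL g) {ε : ℝ}
    (hε : 0 < ε) :
    ∃ δ : ℝ, 0 < δ ∧ ∀ s, MeasurableSet s → mIoo s ≤ ENNReal.ofReal δ → ∀ y : ℝ, 0 < y →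
      ∫ t in s, ‖conjPoisson ((Ioo (-1 : ℝ) 1).indicator g) y t‖ ∂mIoo ≤ ε := by
  have hg' := (integrable_indicator_iff measurableSet_Ioo).mpr hg.integrable
  obtain ⟨δ₁, hδ₁, hg₁⟩ := exists_setIntegral_norm_mul_conjPoisson_le hg (half_pos hε)
  have hI0 : 0 ≤ ∫ t, ‖g t‖ ∂mIoo := integral_nonneg fun t => norm_nonneg _
  set N : ℝ := (∫ t, ‖g t‖ ∂mIoo) / δ₁ + 1 with hN
  have hN0 : 0 < N := by positivity
  set s' := toMeasurable mIoo {t | N ≤ ‖g t‖} with hs'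
  have hs'm : MeasurableSet s' := measurableSet_toMeasurable _ _
  have hμs' : mIoo s' ≤ ENNReal.ofReal δ₁ := by
    rw [hs', measure_toMeasurable]
    refine ENNReal.le_ofReal_iff_toReal_le (measure_ne_top _ _) hδ₁.le |>.mpr ?_
    have h := mul_meas_ge_le_integral_of_nonneg (ae_of_all _ fun t => norm_nonneg (g t))
      hg.integrable.norm N
    have h2 : ∫ t, ‖g t‖ ∂mIoo ≤ N * δ₁ := by
      rw [hN, add_mul, div_mul_cancel₀ _ hδ₁.ne']
      linarith
    exact le_of_mul_le_mul_left (h.trans h2) hN0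
  obtain ⟨δ, hδ, hg₂⟩ := exists_setIntegral_norm_mul_conjPoisson_le
    (memLlogL_of_bounded (g := fun _ => 1) (N := 1) aestronglyMeasurable_const (by simp))
    (show 0 < ε / (2 * N) by positivity)
  refine ⟨δ, hδ, fun s hs hμs y hy => ?_⟩
  obtain ⟨σ, hσ, hσs, h1⟩ := exists_setIntegral_norm_conjPoisson_le_dual hg' hy hs
  obtain ⟨τ, hτ, -, h2⟩ := exists_setIntegral_norm_conjPoisson_le_dual hσ.integrable hy
    MeasurableSet.univ
  rw [integral_norm_indicator_Ioo_mul] at h1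
  rw [setIntegral_univ] at h2
  have hσi : Integrable (conjPoisson σ y) mIoo :=
    (continuous_conjPoisson hσ.integrable hy).integrableOn_Icc.mono_set Ioo_subset_Icc_self
  have h3 : ∫ t, ‖conjPoisson σ y t‖ ∂mIoo ≤ ε / (2 * N) := by
    refine h2.trans (le_trans ?_ (hg₂ s hs hμs τ hτ y hy))
    rw [mIoo, Measure.restrict_restrict hs, ← integral_indicator (hs.inter measurableSet_Ioo)]
    have hτi : Integrable (conjPoisson τ y) mIoo :=
      (continuous_conjPoisson hτ.integrable hy).integrableOn_Icc.mono_set Ioo_subset_Icc_self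
    refine integral_mono (integrable_mul_conjPoisson hσ.integrable hτ.integrable hy).norm ?_
      fun t => ?_
    · refine (integrable_indicator_iff (hs.inter measurableSet_Ioo)).mpr ?_
      simp only [one_mul]
      exact IntegrableOn.mono_set (t := Ioo (-1 : ℝ) 1) hτi.norm inter_subset_right
    · have h4 := hσs t
      beta_reduce
      by_cases ht : t ∈ s ∩ Ioo (-1 : ℝ) 1
      · rw [indicator_of_mem ht] at h4 ⊢
        rw [norm_mul, norm_mul, norm_one]
        gcongr
      · rw [indicator_of_notMem ht] at h4 ⊢
        rw [norm_mul]
        have : ‖σ t‖ = 0 := le_antisymm h4 (norm_nonneg _)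
        rw [this, zero_mul]
  have hgi := (integrable_mul_conjPoisson hg.integrable hσ.integrable hy).norm
  have h5 : ∫ t in s'ᶜ, ‖g t * conjPoisson σ y t‖ ∂mIoo ≤ N * (ε / (2 * N)) := by
    calc _ ≤ ∫ t in s'ᶜ, N * ‖conjPoisson σ y t‖ ∂mIoo := by
          refine setIntegral_mono_on hgi.integrableOn (hσi.norm.const_mul N).integrableOn
            hs'm.compl fun t ht => ?_
          have : ‖g t‖ < N := by
            by_contra hcon
            exact ht (subset_toMeasurable _ _ (not_lt.mp hcon))
          rw [norm_mul]
          gcongr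
      _ ≤ ∫ t, N * ‖conjPoisson σ y t‖ ∂mIoo :=
          setIntegral_le_integral (hσi.norm.const_mul N) (ae_of_all _ fun t => by positivity)
      _ ≤ _ := by
          rw [integral_const_mul]
          gcongr
  have h6 : N * (ε / (2 * N)) = ε / 2 := by field_simp
  have h7 := integral_add_compl hs'm hgi
  have h8 := hg₁ s' hs'm hμs' σ hσ y hy
  linarith

/-- The Parseval formula when one of the functions is bounded. -/
theorem parseval_of_bounded {f g : ℝ → ℂ} (hf : AEStronglyMeasurable f mIoo) {N : ℝ}
    (hN : 0 < N) (hfN : ∀ x, ‖f x‖ ≤ N) (hg : MemLlogL g) :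
    Integrable (fun x => g x * FHT f x) mIoo ∧
      ∫ x, f x * FHT g x ∂mIoo = -∫ x, g x * FHT f x ∂mIoo := by
  have hpi : (Real.pi : ℂ) ≠ 0 := Complex.ofReal_ne_zero.mpr Real.pi_ne_zero
  have hfi : Integrable f mIoo := Integrable.of_bound hf N (ae_of_all _ hfN)
  set f' := (Ioo (-1 : ℝ) 1).indicator f with hf'_def
  set g' := (Ioo (-1 : ℝ) 1).indicator g with hg'_def
  have hf' : Integrable f' := (integrable_indicator_iff measurableSet_Ioo).mpr hfi
  have hg' : Integrable g' := (integrable_indicator_iff measurableSet_Ioo).mpr hg.integrable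
  set a : ℕ → ℝ := fun n => 1 / ((n : ℝ) + 1) with ha
  have ha0 : ∀ n, 0 < a n := fun n => Nat.one_div_pos_of_nat
  have hlim : Tendsto a atTop (𝓝[>] 0) := tendsto_nhdsWithin_iff.mpr
    ⟨tendsto_one_div_add_atTop_nhds_zero_nat, Eventually.of_forall ha0⟩
  set h : ℝ → ℂ := fun x => (N : ℂ)⁻¹ * f' x with hh
  have hhu : IsUnitBounded h := by
    refine isUnitBounded_of_support (hf'.aestronglyMeasurable.const_mul _) fun x => ?_
    rw [hh, hf'_def, norm_mul, norm_indicator_eq_indicator_norm, norm_inv, Complex.norm_real,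
      Real.norm_of_nonneg hN.le]
    by_cases hx : x ∈ Ioo (-1 : ℝ) 1
    · rw [indicator_of_mem hx, indicator_of_mem hx, inv_mul_le_one₀ hN]
      exact hfN x
    · rw [indicator_of_notMem hx, indicator_of_notMem hx, mul_zero]
  have hfh : ∀ y t, conjPoisson f' y t = N * conjPoisson h y t := fun y t => by
    have hN' : (N : ℂ) ≠ 0 := Complex.ofReal_ne_zero.mpr hN.ne'
    simp only [conjPoisson, ← integral_const_mul, hh]
    refine integral_congr_ae (ae_of_all _ fun x => ?_)
    field_simp
  have hgf : ∀ y t, ‖g t * conjPoisson f' y t‖ = N * ‖g t * conjPoisson h y t‖ := fun y t => by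
    rw [hfh, mul_left_comm, norm_mul, Complex.norm_real, Real.norm_of_nonneg hN.le]
  obtain ⟨C₁, hC₁⟩ := exists_integral_norm_mul_conjPoisson_le hg
  obtain ⟨hi, hlim₁⟩ := integrable_and_tendsto_integral_of_vitali (μ := mIoo) (C := N * C₁)
    (u := fun n t => g t * conjPoisson f' (a n) t)
    (v := fun t => g t * (Real.pi * FHT f t))
    (fun n => integrable_mul_conjPoisson hg.integrable hf' (ha0 n))
    (fun n => by
      simp only [hgf, integral_const_mul]
      exact mul_le_mul_of_nonneg_left (hC₁ h hhu _ (ha0 n)) hN.le)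
    (fun ε hε => by
      obtain ⟨δ, hδ, hs⟩ := exists_setIntegral_norm_mul_conjPoisson_le hg (div_pos hε hN)
      refine ⟨δ, hδ, fun n s hsm hμ => ?_⟩
      simp only [hgf, integral_const_mul]
      rw [mul_comm, ← le_div_iff₀ hN]
      exact hs s hsm hμ h hhu _ (ha0 n))
    ((ae_tendsto_conjPoisson_FHT hfi).mono fun t ht => (ht.comp hlim).const_mul _)
  obtain ⟨C₂, hC₂⟩ := exists_integral_norm_conjPoisson_le hg
  have hgc : ∀ n, Integrable (conjPoisson g' (a n)) mIoo := fun n =>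
    (continuous_conjPoisson hg' (ha0 n)).integrableOn_Icc.mono_set Ioo_subset_Icc_self
  have hfg : ∀ n t, ‖f t * conjPoisson g' (a n) t‖ ≤ N * ‖conjPoisson g' (a n) t‖ := fun n t => by
    rw [norm_mul]
    exact mul_le_mul_of_nonneg_right (hfN t) (norm_nonneg _)
  have hfgi : ∀ n, Integrable (fun t => f t * conjPoisson g' (a n) t) mIoo := fun n =>
    integrable_mul_conjPoisson hfi hg' (ha0 n)
  obtain ⟨-, hlim₂⟩ := integrable_and_tendsto_integral_of_vitali (μ := mIoo) (C := N * C₂)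
    (u := fun n t => f t * conjPoisson g' (a n) t)
    (v := fun t => f t * (Real.pi * FHT g t)) hfgi
    (fun n => by
      refine (integral_mono (hfgi n).norm ((hgc n).norm.const_mul N) (hfg n)).trans ?_
      rw [integral_const_mul]
      exact mul_le_mul_of_nonneg_left (hC₂ _ (ha0 n)) hN.le)
    (fun ε hε => by
      obtain ⟨δ, hδ, hs⟩ := exists_setIntegral_norm_conjPoisson_le hg (div_pos hε hN)
      refine ⟨δ, hδ, fun n s hsm hμ => ?_⟩
      refine (setIntegral_mono (hfgi n).norm.integrableOn
        ((hgc n).norm.const_mul N).integrableOn (hfg n)).trans ?_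
      rw [integral_const_mul, mul_comm, ← le_div_iff₀ hN]
      exact hs s hsm hμ _ (ha0 n))
    ((ae_tendsto_conjPoisson_FHT hg.integrable).mono fun t ht => (ht.comp hlim).const_mul _)
  have hswap : ∀ n, ∫ t, f t * conjPoisson g' (a n) t ∂mIoo =
      -∫ t, g t * conjPoisson f' (a n) t ∂mIoo := fun n => by
    rw [← integral_indicator_Ioo_mul, ← integral_indicator_Ioo_mul]
    exact integral_mul_conjPoisson hf' hg' (ha0 n)
  simp only [hswap] at hlim₂
  have heq := tendsto_nhds_unique hlim₂ hlim₁.neg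
  simp only [mul_left_comm _ (Real.pi : ℂ), integral_const_mul] at heq hi
  rw [← mul_neg] at heq
  refine ⟨(hi.const_mul (Real.pi : ℂ)⁻¹).congr (ae_of_all _ fun t => inv_mul_cancel_left₀ hpi _),
    mul_left_cancel₀ hpi heq⟩

theorem exists_subset_setIntegral_norm_le {α : Type*} [MeasurableSpace α] {μ : Measure α}
    {h : α → ℝ} (hh : Integrable h μ) {B : Set α} (hB : MeasurableSet B) :
    ∃ A ⊆ B, MeasurableSet A ∧ ∫ x in B, ‖h x‖ ∂μ ≤ 2 * |∫ x in A, h x ∂μ| := by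
  obtain ⟨k, hk, hhk⟩ := hh.aestronglyMeasurable
  have hkm : MeasurableSet {x | 0 ≤ k x} := measurableSet_le measurable_const hk.measurable
  have hki : Integrable k μ := hh.congr hhk
  have hint : ∀ s : Set α, ∫ x in s, h x ∂μ = ∫ x in s, k x ∂μ := fun s =>
    integral_congr_ae (ae_restrict_of_ae hhk)
  have hpos : ∫ x in B ∩ {x | 0 ≤ k x}, ‖k x‖ ∂μ = ∫ x in B ∩ {x | 0 ≤ k x}, k x ∂μ :=
    setIntegral_congr_fun (hB.inter hkm) fun x hx => Real.norm_of_nonneg hx.2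
  have hneg : ∫ x in B \ {x | 0 ≤ k x}, ‖k x‖ ∂μ = -∫ x in B \ {x | 0 ≤ k x}, k x ∂μ := by
    rw [← integral_neg]
    exact setIntegral_congr_fun (hB.diff hkm) fun x hx =>
      Real.norm_of_nonpos (not_le.mp hx.2).le
  have hsum := integral_inter_add_sdiff (s := B) hkm hki.norm.integrableOn
  have hnorm : ∫ x in B, ‖h x‖ ∂μ = ∫ x in B, ‖k x‖ ∂μ :=
    integral_congr_ae (ae_restrict_of_ae (hhk.mono fun x hx => by simp only [hx]))
  rcases le_total (∫ x in B \ {x | 0 ≤ k x}, ‖k x‖ ∂μ) (∫ x in B ∩ {x | 0 ≤ k x}, ‖k x‖ ∂μ)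
    with hle | hle
  · refine ⟨B ∩ {x | 0 ≤ k x}, inter_subset_left, hB.inter hkm, ?_⟩
    rw [hint, hnorm]
    linarith [le_abs_self (∫ x in B ∩ {x | 0 ≤ k x}, k x ∂μ)]
  · refine ⟨B \ {x | 0 ≤ k x}, sdiff_subset, hB.diff hkm, ?_⟩
    rw [hint, hnorm]
    linarith [neg_le_abs (∫ x in B \ {x | 0 ≤ k x}, k x ∂μ)]

theorem tendsto_setIntegral_compl_zero {α : Type*} [MeasurableSpace α] {μ : Measure α}
    {h : α → ℝ} (hh : Integrable h μ) {E : ℕ → Set α} (hE : ∀ j, MeasurableSet (E j))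
    (hmono : Monotone E) (hfull : ∀ᵐ x ∂μ, ∃ j, x ∈ E j) :
    Tendsto (fun j => ∫ x in (E j)ᶜ, h x ∂μ) atTop (𝓝 0) := by
  have hanti : Antitone fun j => (E j)ᶜ := fun i j hij => compl_subset_compl.mpr (hmono hij)
  have := tendsto_setIntegral_of_antitone (fun j => (hE j).compl) hanti ⟨0, hh.integrableOn⟩
  have hnull : μ (⋂ j, (E j)ᶜ) = 0 := by
    simpa [ae_iff, compl_def, ← ofPred_forall] using hfull
  rwa [setIntegral_measure_zero _ hnull] at this

/-- Gliding hump: measures with densities `ν i` that converge to zero setwise, and in total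
variation on each member of an exhausting sequence, converge to zero in total variation. -/
theorem tendsto_integral_norm_zero_of_setwise {α : Type*} [MeasurableSpace α] {μ : Measure α}
    {ν : ℕ → α → ℝ} (hν : ∀ i, Integrable (ν i) μ)
    (hset : ∀ A, MeasurableSet A → Tendsto (fun i => ∫ x in A, ν i x ∂μ) atTop (𝓝 0))
    {E : ℕ → Set α} (hE : ∀ j, MeasurableSet (E j)) (hmono : Monotone E)
    (hfull : ∀ᵐ x ∂μ, ∃ j, x ∈ E j)
    (hEν : ∀ j, Tendsto (fun i => ∫ x in E j, ‖ν i x‖ ∂μ) atTop (𝓝 0)) :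
    Tendsto (fun i => ∫ x, ‖ν i x‖ ∂μ) atTop (𝓝 0) := by
  by_contra hnot
  obtain ⟨ε, hε, hfreq⟩ : ∃ ε > 0, ∃ᶠ i in atTop, ε ≤ ∫ x, ‖ν i x‖ ∂μ := by
    by_contra! hcon
    refine hnot (Metric.tendsto_nhds.mpr fun ε hε => ?_)
    filter_upwards [hcon ε hε] with i hi
    rw [Real.dist_0_eq_abs, abs_of_nonneg (integral_nonneg fun x => norm_nonneg _)]
    exact hi
  have hstep : ∀ p : ℕ × ℕ × Set α, ∃ q : ℕ × ℕ × Set α, p.1 < q.1 ∧ p.2.1 ≤ q.2.1 ∧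
      MeasurableSet q.2.2 ∧ q.2.2 ⊆ E q.2.1 \ E p.2.1 ∧
      ∫ x in E p.2.1, ‖ν q.1 x‖ ∂μ ≤ ε / 12 ∧ ∫ x in (E q.2.1)ᶜ, ‖ν q.1 x‖ ∂μ ≤ ε / 12 ∧
      5 * ε / 12 ≤ |∫ x in q.2.2, ν q.1 x ∂μ| := by
    rintro ⟨i₀, j₀, _⟩
    obtain ⟨i, hiε, hi₀, hiE⟩ := (hfreq.and_eventually ((eventually_gt_atTop i₀).and
      ((hEν j₀).eventually_le_const (by positivity : 0 < ε / 12)))).exists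
    obtain ⟨j, hj₀, hjE⟩ := ((eventually_ge_atTop j₀).and ((tendsto_setIntegral_compl_zero
      (hν i).norm hE hmono hfull).eventually_le_const (by positivity : 0 < ε / 12))).exists
    obtain ⟨A, hAB, hA, hAν⟩ := exists_subset_setIntegral_norm_le (hν i) ((hE j).diff (hE j₀))
    refine ⟨⟨i, j, A⟩, hi₀, hj₀, hA, hAB, hiE, hjE, ?_⟩
    have h1 := integral_add_compl (hE j) (hν i).norm
    have h2 := integral_inter_add_sdiff (s := E j) (hE j₀) (hν i).norm.integrableOn
    rw [inter_eq_right.mpr (hmono hj₀)] at h2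
    dsimp only at *
    linarith
  choose F hF1 hF2 hF3 hF4 hF5 hF6 hF7 using hstep
  set p : ℕ → ℕ × ℕ × Set α := fun n => F^[n] (0, 0, ∅) with hp
  have hps : ∀ n, p (n + 1) = F (p n) := fun n => Function.iterate_succ_apply' F n _
  have hi : StrictMono fun n => (p n).1 := strictMono_nat_of_lt_succ fun n => by
    rw [hps]; exact hF1 _
  have hj : Monotone fun n => (p n).2.1 := monotone_nat_of_le_succ fun n => by
    rw [hps]; exact hF2 _
  set A : Set α := ⋃ n, (p (n + 1)).2.2 with hA
  have hAm : ∀ n, MeasurableSet (p (n + 1)).2.2 := fun n => by rw [hps]; exact hF3 _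
  have hAE : ∀ n, (p (n + 1)).2.2 ⊆ E (p (n + 1)).2.1 \ E (p n).2.1 := fun n => by
    rw [hps]; exact hF4 _
  have hbig : ∀ n, ε / 4 ≤ |∫ x in A, ν (p (n + 1)).1 x ∂μ| := fun n => by
    have hsub : A \ (p (n + 1)).2.2 ⊆ E (p n).2.1 ∪ (E (p (n + 1)).2.1)ᶜ := by
      rintro x ⟨hxA, hxn⟩
      obtain ⟨m, hm⟩ := mem_iUnion.mp hxA
      rcases lt_trichotomy m n with hmn | rfl | hmn
      · exact Or.inl (hmono (hj (Nat.succ_le_of_lt hmn)) (hAE m hm).1)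
      · exact absurd hm hxn
      · exact Or.inr fun hx => (hAE m hm).2 (hmono (hj (Nat.succ_le_of_lt hmn)) hx)
    have hsplit := integral_inter_add_sdiff (s := A) (hAm n) (hν (p (n + 1)).1).integrableOn
    rw [inter_eq_right.mpr (subset_iUnion (fun n => (p (n + 1)).2.2) n)] at hsplit
    have hrest : |∫ x in A \ (p (n + 1)).2.2, ν (p (n + 1)).1 x ∂μ| ≤ ε / 6 := by
      calc _ ≤ ∫ x in A \ (p (n + 1)).2.2, ‖ν (p (n + 1)).1 x‖ ∂μ :=
            norm_integral_le_integral_norm _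
        _ ≤ ∫ x in E (p n).2.1 ∪ (E (p (n + 1)).2.1)ᶜ, ‖ν (p (n + 1)).1 x‖ ∂μ :=
            setIntegral_mono_set (hν _).norm.integrableOn (ae_of_all _ fun x => norm_nonneg _)
              hsub.eventuallyLE
        _ = (∫ x in E (p n).2.1, ‖ν (p (n + 1)).1 x‖ ∂μ) +
            ∫ x in (E (p (n + 1)).2.1)ᶜ, ‖ν (p (n + 1)).1 x‖ ∂μ :=
            setIntegral_union (disjoint_compl_right.mono_left (hmono (hj n.le_succ)))
              (hE _).compl (hν _).norm.integrableOn (hν _).norm.integrableOn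
        _ ≤ ε / 6 := by
            have h5 := hF5 (p n)
            have h6 := hF6 (p n)
            rw [← hps] at h5 h6
            linarith
    have h7 := hF7 (p n)
    rw [← hps] at h7
    have h8 := abs_sub_abs_le_abs_sub (∫ x in (p (n + 1)).2.2, ν (p (n + 1)).1 x ∂μ)
      (-∫ x in A \ (p (n + 1)).2.2, ν (p (n + 1)).1 x ∂μ)
    rw [sub_neg_eq_add, hsplit, abs_neg] at h8
    linarith
  have hlim := ((hset A (MeasurableSet.iUnion hAm)).comp
    (hi.tendsto_atTop.comp (tendsto_add_atTop_nat 1))).abs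
  rw [abs_zero] at hlim
  have := ge_of_tendsto' hlim hbig
  linarith

theorem tendsto_integral_norm_zero_of_setwise_of_ae {α : Type*} [MeasurableSpace α]
    {μ : Measure α} {ν : ℕ → α → ℂ} (hν : ∀ i, Integrable (ν i) μ)
    (hset : ∀ A, MeasurableSet A → Tendsto (fun i => ∫ x in A, ν i x ∂μ) atTop (𝓝 0))
    {E : ℕ → Set α} (hE : ∀ j, MeasurableSet (E j)) (hmono : Monotone E)
    (hfull : ∀ᵐ x ∂μ, ∃ j, x ∈ E j)
    (hEν : ∀ j, Tendsto (fun i => ∫ x in E j, ‖ν i x‖ ∂μ) atTop (𝓝 0)) :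
    Tendsto (fun i => ∫ x, ‖ν i x‖ ∂μ) atTop (𝓝 0) := by
  have hre := tendsto_integral_norm_zero_of_setwise (ν := fun i x => (ν i x).re)
    (fun i => (hν i).re) (fun A hA => by
      have := (Complex.continuous_re.tendsto _).comp (hset A hA)
      refine (this.congr fun i => ?_)
      exact (integral_re (hν i).integrableOn).symm) hE hmono hfull fun j =>
    squeeze_zero (fun i => integral_nonneg fun x => norm_nonneg _) (fun i =>
      integral_mono (hν i).re.norm.integrableOn (hν i).norm.integrableOn
        fun x => Complex.abs_re_le_norm _) (hEν j)
  have him := tendsto_integral_norm_zero_of_setwise (ν := fun i x => (ν i x).im)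
    (fun i => (hν i).im) (fun A hA => by
      have := (Complex.continuous_im.tendsto _).comp (hset A hA)
      refine (this.congr fun i => ?_)
      exact (integral_im (hν i).integrableOn).symm) hE hmono hfull fun j =>
    squeeze_zero (fun i => integral_nonneg fun x => norm_nonneg _) (fun i =>
      integral_mono (hν i).im.norm.integrableOn (hν i).norm.integrableOn
        fun x => Complex.abs_im_le_norm _) (hEν j)
  have hadd := hre.add him
  rw [add_zero] at hadd
  refine squeeze_zero (fun i => integral_nonneg fun x => norm_nonneg _) (fun i => ?_) hadd
  exact (integral_mono (hν i).norm ((hν i).re.norm.add (hν i).im.norm)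
    fun x => Complex.norm_le_abs_re_add_abs_im _).trans_eq
      (integral_add (hν i).re.norm (hν i).im.norm)

/-- **Vitali–Hahn–Saks**, for an almost everywhere convergent sequence of densities. -/
theorem integrable_and_tendsto_integral_of_setwise {α : Type*} [MeasurableSpace α]
    {μ : Measure α} [IsFiniteMeasure μ] {u : ℕ → α → ℂ} {v : α → ℂ}
    (hu : ∀ n, Integrable (u n) μ)
    (hset : ∀ A, MeasurableSet A → ∃ c, Tendsto (fun n => ∫ x in A, u n x ∂μ) atTop (𝓝 c))
    (hlim : ∀ᵐ x ∂μ, Tendsto (fun n => u n x) atTop (𝓝 (v x))) :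
    Integrable v μ ∧ Tendsto (fun n => ∫ x, u n x ∂μ) atTop (𝓝 (∫ x, v x ∂μ)) := by
  let k : ℕ → α → ℂ := fun n => (hu n).1.mk (u n)
  have hk : ∀ᵐ x ∂μ, ∀ n, u n x = k n x := ae_all_iff.mpr fun n => (hu n).1.ae_eq_mk
  let E : ℕ → Set α := fun j => {x | ∀ n, ‖k n x‖ ≤ j}
  have hE : ∀ j, MeasurableSet (E j) := fun j => by
    simp only [E, ofPred_forall]
    exact MeasurableSet.iInter fun n => measurableSet_le
      ((hu n).1.stronglyMeasurable_mk.norm.measurable) measurable_const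
  have hmono : Monotone E := fun i j hij x hx n => (hx n).trans (Nat.cast_le.mpr hij)
  have hfull : ∀ᵐ x ∂μ, ∃ j, x ∈ E j := by
    filter_upwards [hk, hlim] with x hx hl
    obtain ⟨C, hC⟩ := hl.norm.bddAbove_range
    obtain ⟨j, hj⟩ := exists_nat_ge C
    exact ⟨j, fun n => hx n ▸ (hC (mem_range_self n)).trans hj⟩
  have hcauchy : ∀ m n : ℕ → ℕ, Tendsto m atTop atTop → Tendsto n atTop atTop →
      Tendsto (fun i => ∫ x, ‖u (m i) x - u (n i) x‖ ∂μ) atTop (𝓝 0) := fun m n hm hn => by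
    refine tendsto_integral_norm_zero_of_setwise_of_ae (fun i => (hu (m i)).sub (hu (n i)))
      (fun A hA => ?_) hE hmono hfull fun j => ?_
    · obtain ⟨c, hc⟩ := hset A hA
      have := (hc.comp hm).sub (hc.comp hn)
      rw [sub_self] at this
      exact this.congr fun i =>
        (integral_sub (hu (m i)).integrableOn (hu (n i)).integrableOn).symm
    · rw [← integral_zero α ℝ (μ := μ.restrict (E j))]
      refine tendsto_integral_of_dominated_convergence (fun _ => (j + j : ℝ))
        (fun i => ((hu (m i)).sub (hu (n i))).norm.integrableOn.1) (integrable_const _)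
        (fun i => ?_) ?_
      · filter_upwards [ae_restrict_of_ae hk, ae_restrict_mem (hE j)] with x hx hxE
        rw [norm_norm, hx, hx]
        exact (norm_sub_le _ _).trans (add_le_add (hxE _) (hxE _))
      · filter_upwards [ae_restrict_of_ae hlim] with x hx
        have := ((hx.comp hm).sub (hx.comp hn)).norm
        rwa [sub_self, norm_zero] at this
  have hC : ∀ ε : ℝ, 0 < ε → ∃ N, ∀ m ≥ N, ∀ n ≥ N, ∫ x, ‖u m x - u n x‖ ∂μ ≤ ε := by
    intro ε hε
    by_contra! hcon
    choose m hm n hn hmn using hcon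
    have := ge_of_tendsto' (hcauchy m n (tendsto_atTop_mono hm tendsto_id)
      (tendsto_atTop_mono hn tendsto_id)) fun i => (hmn i).le
    linarith
  have hC' : ∀ ε : ℝ, 0 < ε → ∀ᶠ m in atTop, eLpNorm (u m - v) 1 μ ≤ ENNReal.ofReal ε := by
    intro ε hε
    obtain ⟨N, hN⟩ := hC ε hε
    filter_upwards [eventually_ge_atTop N] with m hm
    refine (Lp.eLpNorm_lim_le_liminf_eLpNorm (f := fun n => u m - u n)
      (fun n => ((hu m).sub (hu n)).1) _ (hlim.mono fun x hx => hx.const_sub (u m x))).trans ?_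
    refine liminf_le_of_frequently_le' (Eventually.frequently ?_)
    filter_upwards [eventually_ge_atTop N] with n hn
    rw [eLpNorm_one_eq_lintegral_enorm, ← ofReal_integral_norm_eq_lintegral_enorm
      ((hu m).sub (hu n))]
    exact ENNReal.ofReal_le_ofReal (hN m hm n hn)
  have hvm : AEStronglyMeasurable v μ := aestronglyMeasurable_of_tendsto_ae atTop
    (fun n => (hu n).1) hlim
  have hv : Integrable v μ := by
    obtain ⟨m, hm⟩ := (hC' 1 one_pos).exists
    have h1 : Integrable (u m - v) μ := memLp_one_iff_integrable.mp
      ⟨(hu m).1.sub hvm, hm.trans_lt ENNReal.ofReal_lt_top⟩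
    simpa using (hu m).sub h1
  refine ⟨hv, tendsto_integral_of_L1' v hvm (Eventually.of_forall hu) ?_⟩
  rw [ENNReal.tendsto_nhds_zero]
  intro ε hε
  rcases eq_or_ne ε ⊤ with rfl | hε'
  · simp
  · simpa [ENNReal.ofReal_toReal hε'] using hC' ε.toReal (ENNReal.toReal_pos hε.ne' hε')

theorem FHT_congr_ae {f g : ℝ → ℂ} (h : f =ᵐ[mIoo] g) (t : ℝ) (ht : t ∈ Ioo (-1 : ℝ) 1) :
    FHT f t = FHT g t := by
  have h1 : ∀ s ⊆ Ioo (-1 : ℝ) 1, ∫ x in s, f x / (↑x - ↑t) = ∫ x in s, g x / (↑x - ↑t) :=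
    fun s hs => integral_congr_ae
      ((ae_restrict_of_ae_restrict_of_subset hs h).mono fun x hx => by simp only [hx])
  refine congrArg (@lim ℂ _ _) (Filter.map_congr ?_)
  filter_upwards [self_mem_nhdsWithin] with ε hε
  rw [h1 _ (Ioo_subset_Ioo_right (by linarith [ht.2, mem_Ioi.mp hε])),
    h1 _ (Ioo_subset_Ioo_left (by linarith [ht.1, mem_Ioi.mp hε]))]

theorem FHT_sub_ae {f g : ℝ → ℂ} (hf : Integrable f mIoo) (hg : Integrable g mIoo) :
    ∀ᵐ t ∂mIoo, FHT (fun x => f x - g x) t = FHT f t - FHT g t := by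
  have hI : ∀ {h : ℝ → ℂ}, Integrable h mIoo → Integrable ((Ioo (-1 : ℝ) 1).indicator h) :=
    fun hh => (integrable_indicator_iff measurableSet_Ioo).mpr hh
  filter_upwards [ae_tendsto_conjPoisson_FHT hf, ae_tendsto_conjPoisson_FHT hg,
    ae_tendsto_conjPoisson_FHT (hf.sub hg)] with t h1 h2 h3
  have h4 : Tendsto (fun y => conjPoisson ((Ioo (-1 : ℝ) 1).indicator (f - g)) y t) (𝓝[>] 0)
      (𝓝 (Real.pi * FHT f t - Real.pi * FHT g t)) := by
    refine (h1.sub h2).congr' ?_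
    filter_upwards [self_mem_nhdsWithin] with y hy
    rw [indicator_sub']
    exact (conjPoisson_sub (hI hf) (hI hg) hy t).symm
  have h5 := tendsto_nhds_unique h3 h4
  rw [← mul_sub] at h5
  exact mul_left_cancel₀ (Complex.ofReal_ne_zero.mpr Real.pi_ne_zero) h5

/-- Truncations of an integrable function converge to it rapidly in `L¹`. -/
theorem exists_setIntegral_norm_gt_le_pow {α : Type*} [MeasurableSpace α] {μ : Measure α}
    {f : α → ℂ} (hf : Integrable f μ) (hm : StronglyMeasurable f) (k : ℕ) :
    ∃ n : ℕ, 0 < n ∧ k ≤ n ∧ ∫ x in {x | ‖f x‖ ≤ n}ᶜ, ‖f x‖ ∂μ ≤ (1 / 2 : ℝ) ^ k := by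
  have hmeas : ∀ n : ℕ, MeasurableSet {x | ‖f x‖ ≤ n} := fun n =>
    measurableSet_le hm.norm.measurable measurable_const
  have := tendsto_setIntegral_compl_zero hf.norm hmeas
    (fun i j hij x hx => le_trans (show ‖f x‖ ≤ i from hx) (Nat.cast_le.mpr hij))
    (ae_of_all _ fun x => exists_nat_ge ‖f x‖)
  obtain ⟨n, h1, h2⟩ := ((eventually_ge_atTop (k + 1)).and
    (this.eventually_le_const (by positivity : (0 : ℝ) < (1 / 2) ^ k))).exists
  exact ⟨n, by omega, by omega, h2⟩

theorem parseval_of_stronglyMeasurable {f g : ℝ → ℂ} (hm : StronglyMeasurable f)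
    (hf : Integrable f mIoo) (hg : MemLlogL g)
    (hfA : ∀ A : Set ℝ, MeasurableSet A →
      Integrable (fun x => f x * FHT (A.indicator g) x) mIoo) :
    Integrable (fun x => g x * FHT f x) mIoo ∧
      ∫ x, f x * FHT g x ∂mIoo = -∫ x, g x * FHT f x ∂mIoo := by
  choose n hn0 hnk hn using exists_setIntegral_norm_gt_le_pow hf hm
  set D : ℕ → Set ℝ := fun k => {x | ‖f x‖ ≤ n k} with hD
  have hDm : ∀ k, MeasurableSet (D k) := fun k =>
    measurableSet_le hm.norm.measurable measurable_const
  have hfk : ∀ k, Integrable ((D k).indicator f) mIoo := fun k => hf.indicator (hDm k)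
  have hbdd : ∀ k x, ‖(D k).indicator f x‖ ≤ n k := fun k x => by
    by_cases hx : x ∈ D k
    · rw [indicator_of_mem hx]; exact hx
    · rw [indicator_of_notMem hx, norm_zero]; positivity
  have hD_event : ∀ x, ∀ᶠ k in atTop, x ∈ D k := fun x => by
    obtain ⟨j, hj⟩ := exists_nat_ge ‖f x‖
    filter_upwards [eventually_ge_atTop j] with k hk
    exact hj.trans (Nat.cast_le.mpr (hk.trans (hnk k)))
  have hpar : ∀ k (A : Set ℝ), MeasurableSet A →
      Integrable (fun x => A.indicator g x * FHT ((D k).indicator f) x) mIoo ∧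
      ∫ x, (D k).indicator f x * FHT (A.indicator g) x ∂mIoo =
        -∫ x, A.indicator g x * FHT ((D k).indicator f) x ∂mIoo := fun k A hA =>
    parseval_of_bounded (hfk k).1 (Nat.cast_pos.mpr (hn0 k)) (hbdd k) (hg.indicator hA)
  have hsetlim : ∀ A, MeasurableSet A → Tendsto
      (fun k => ∫ x in A, g x * FHT ((D k).indicator f) x ∂mIoo) atTop
      (𝓝 (-∫ x, f x * FHT (A.indicator g) x ∂mIoo)) := fun A hA => by
    have h1 : ∀ k, ∫ x in A, g x * FHT ((D k).indicator f) x ∂mIoo =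
        -∫ x, (D k).indicator f x * FHT (A.indicator g) x ∂mIoo := fun k => by
      rw [(hpar k A hA).2, neg_neg, ← integral_indicator hA]
      simp only [indicator_mul_left]
    simp only [h1]
    refine (tendsto_integral_of_dominated_convergence
      (fun x => ‖f x * FHT (A.indicator g) x‖) (fun k => ?_) (hfA A hA).norm
      (fun k => ae_of_all _ fun x => ?_) (ae_of_all _ fun x => ?_)).neg
    · exact ((hfk k).1.mul (aestronglyMeasurable_FHT (hg.indicator hA).integrable))
    · rw [norm_mul, norm_mul]
      exact mul_le_mul_of_nonneg_right (norm_indicator_le_norm_self _ _) (norm_nonneg _)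
    · refine tendsto_const_nhds.congr' ?_
      filter_upwards [hD_event x] with k hk
      rw [indicator_of_mem hk]
  have hsum : Summable fun k => ∫ x, ‖f x - (D k).indicator f x‖ ∂mIoo := by
    refine Summable.of_nonneg_of_le (fun k => integral_nonneg fun x => norm_nonneg _)
      (fun k => ?_) summable_geometric_two
    refine le_trans (le_of_eq ?_) (hn k)
    rw [← integral_indicator (hDm k).compl]
    refine integral_congr_ae (ae_of_all _ fun x => ?_)
    beta_reduce
    by_cases hx : x ∈ D k
    · rw [indicator_of_mem hx, indicator_of_notMem (notMem_compl_iff.mpr hx), sub_self, norm_zero]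
    · rw [indicator_of_notMem hx, indicator_of_mem (mem_compl hx), sub_zero]
  have hae : ∀ᵐ t ∂mIoo, Tendsto (fun k => g t * FHT ((D k).indicator f) t) atTop
      (𝓝 (g t * FHT f t)) := by
    filter_upwards [ae_tendsto_FHT_zero_of_summable (fun k => hf.sub (hfk k)) hsum,
      ae_all_iff.mpr fun k => FHT_sub_ae hf (hfk k)] with t h1 h2
    have h3 : Tendsto (fun k => FHT f t - FHT ((D k).indicator f) t) atTop (𝓝 0) :=
      h1.congr h2
    have h4 := (h3.const_sub (FHT f t)).const_mul (g t)
    simpa only [sub_sub_cancel, sub_zero] using h4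
  have huniv : ∀ k, Integrable (fun x => g x * FHT ((D k).indicator f) x) mIoo := fun k => by
    simpa only [indicator_univ] using (hpar k univ MeasurableSet.univ).1
  obtain ⟨hint, hlim⟩ := integrable_and_tendsto_integral_of_setwise huniv
    (fun A hA => ⟨_, hsetlim A hA⟩) hae
  have h5 := hsetlim univ MeasurableSet.univ
  simp only [indicator_univ, setIntegral_univ] at h5
  exact ⟨hint, by rw [tendsto_nhds_unique hlim h5, neg_neg]⟩

/-- Parseval formula for the finite Hilbert transform.
If `f ∈ L¹(-1,1)`, `g ∈ L log L` and `f · T(g χ_A) ∈ L¹` for every Borel set `A`,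
then `g · T(f) ∈ L¹` and `∫ f T(g) = -∫ g T(f)`. -/
theorem stmt0 (f g : ℝ → ℂ)
    (hf : MeasureTheory.Integrable f mIoo)
    (hg : MemLlogL g)
    (hfA : ∀ A : Set ℝ, MeasurableSet A →
      MeasureTheory.Integrable (fun x => f x * FHT (A.indicator g) x) mIoo) :
    MeasureTheory.Integrable (fun x => g x * FHT f x) mIoo ∧
      ∫ x, f x * FHT g x ∂mIoo = -∫ x, g x * FHT f x ∂mIoo := by
  have hk := hf.1.ae_eq_mk
  have hmul : ∀ h : ℝ → ℂ, (fun x => f x * h x) =ᵐ[mIoo] fun x => hf.1.mk f x * h x :=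
    fun h => hk.mono fun x hx => by simp only [← hx]
  have hFHT : (fun x => g x * FHT f x) =ᵐ[mIoo] fun x => g x * FHT (hf.1.mk f) x := by
    filter_upwards [ae_restrict_mem measurableSet_Ioo] with x hx
    rw [FHT_congr_ae hk x hx]
  have := parseval_of_stronglyMeasurable hf.1.stronglyMeasurable_mk (hf.congr hk) hg
    fun A hA => (hfA A hA).congr (hmul _)
  rw [integral_congr_ae (hmul _), integral_congr_ae hFHT]
  exact ⟨this.1.congr hFHT.symm, this.2⟩
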